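/- arXiv:2111.12822 — 8 statements merged into one kernel-verified Lean document; each statement's English description precedes it below -/
import Mathlib

section
/- Let f be a mixture gamma density with parameters L, {α_l}, {β_l}, {ζ_l}, and let m be an MMSE-type function with induced quantities I, I_∞, M̂. Then the average mutual information Ī(γ̄) = ∫_0^∞ f(a) I(γ̄ a) da satisfies, as γ̄ → ∞, Ī(γ̄) = I_∞ − G_a · γ̄^{−β_1} + O(γ̄^{−β_1−1}), where G_a = (1/β_1) · (Σ_{l : β_l = β_1} α_l) · M̂(β_1), and moreover 0 < G_a < ∞. (That is, there exist constants C′ > 0 and γ_0 > 0 such that |Ī(γ̄) − I_∞ + G_a γ̄^{−β_1}| ≤ C′ γ̄^{−β_1−1} for all γ̄ ≥ γ_0.) -/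
open MeasureTheory Real Filter Set

/-- A continuous function on `(0, ∞)` with a limit at `0⁺` and exponential decay at infinity is
dominated by a single exponential. -/
lemma exists_le_mul_exp_neg {m : ℝ → ℝ} (hm_cont : ContinuousOn m (Set.Ioi 0)) {y : ℝ}
    (hm_lim : Tendsto m (nhdsWithin 0 (Set.Ioi 0)) (nhds y)) {C c : ℝ} (hC : 0 < C)
    (hc : 0 < c) (hm : ∀ t ≥ 1, m t ≤ C * Real.exp (-c * t)) :
    ∃ D > 0, ∀ t > 0, m t ≤ D * Real.exp (-c * t) := by
  have hev : ∀ᶠ t in nhdsWithin 0 (Set.Ioi 0), m t < |y| + 1 :=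
    hm_lim.eventually_lt_const (by linarith [le_abs_self y])
  obtain ⟨δ, hδ, hδm⟩ := mem_nhdsGT_iff_exists_Ioo_subset.1 hev
  have hδ0 : 0 < δ := hδ
  obtain ⟨B, hB⟩ := isCompact_Icc.exists_bound_of_continuousOn
    (hm_cont.mono (fun t ht => lt_of_lt_of_le hδ0 ht.1 : Icc δ 1 ⊆ Ioi 0))
  set E := |y| + 1 + |B|
  have hE : 0 ≤ E := by positivity
  refine ⟨C + E * Real.exp c, by positivity, fun t ht => ?_⟩
  rcases le_total 1 t with h1 | h1
  · refine (hm t h1).trans ?_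
    gcongr
    linarith [mul_nonneg hE (Real.exp_pos c).le]
  · have hmE : m t ≤ E := by
      rcases lt_or_ge t δ with h | h
      · have : m t < |y| + 1 := hδm ⟨ht, h⟩
        linarith [abs_nonneg B]
      · have := hB t ⟨h, h1⟩
        linarith [le_abs_self (m t), Real.norm_eq_abs (m t), le_abs_self B, abs_nonneg y]
    have hexp : 1 ≤ Real.exp c * Real.exp (-c * t) := by
      rw [← Real.exp_add]
      exact Real.one_le_exp (by nlinarith)
    nlinarith [Real.exp_pos (-c * t)]

lemma integrableOn_rpow_mul_of_le_exp {m : ℝ → ℝ} (hm_cont : ContinuousOn m (Set.Ioi 0))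
    (hm_nonneg : ∀ t > 0, 0 ≤ m t) {D c : ℝ} (hc : 0 < c)
    (hm : ∀ t > 0, m t ≤ D * Real.exp (-c * t)) {b : ℝ} (hb : -1 < b) :
    IntegrableOn (fun t => t ^ b * m t) (Ioi 0) := by
  have h := (integrableOn_rpow_mul_exp_neg_mul_rpow hb one_pos hc).const_mul D
  refine Integrable.mono' h ?_ ?_
  · refine ContinuousOn.aestronglyMeasurable (fun t ht => ?_) measurableSet_Ioi
    exact ((Real.continuousAt_rpow_const t b (Or.inl (ne_of_gt ht))).continuousWithinAt).mul
      (hm_cont t ht)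
  · filter_upwards [ae_restrict_mem measurableSet_Ioi] with t ht
    have ht0 : 0 < t := ht
    rw [Real.norm_of_nonneg (mul_nonneg (by positivity) (hm_nonneg t ht)), Real.rpow_one]
    calc t ^ b * m t ≤ t ^ b * (D * Real.exp (-c * t)) := by gcongr; exact hm t ht
      _ = _ := by ring

/-- The tail integral of a function nonnegative on `(0, ∞)` is antitone there. -/
lemma antitoneOn_tail_integral {m : ℝ → ℝ} (hm_nonneg : ∀ t > 0, 0 ≤ m t)
    (hm_int : IntegrableOn m (Ioi 0)) :
    AntitoneOn (fun s => ∫ t in Ioi s, m t) (Ioi 0) := by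
  intro s hs r _ hsr
  have hs0 : 0 < s := hs
  refine setIntegral_mono_set (hm_int.mono_set (Ioi_subset_Ioi hs0.le)) ?_
    (Ioi_subset_Ioi hsr).eventuallyLE
  filter_upwards [ae_restrict_mem measurableSet_Ioi] with t ht
  exact hm_nonneg t (hs0.trans ht)

lemma tail_integral_nonneg {m : ℝ → ℝ} (hm_nonneg : ∀ t > 0, 0 ≤ m t) {s : ℝ} (hs : 0 ≤ s) :
    0 ≤ ∫ t in Ioi s, m t :=
  setIntegral_nonneg measurableSet_Ioi fun t ht => hm_nonneg t (hs.trans_lt ht)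

lemma aestronglyMeasurable_rpow_restrict_Ioi (b : ℝ) :
    AEStronglyMeasurable (fun t : ℝ => t ^ b) (volume.restrict (Ioi 0)) :=
  (measurable_id.pow_const b).aestronglyMeasurable

/-- Layer-cake formula for moments, in terms of the tail integral. -/
lemma integral_rpow_mul_tail {m : ℝ → ℝ} (hm_nonneg : ∀ t > 0, 0 ≤ m t)
    (hm_int : IntegrableOn m (Ioi 0)) {b : ℝ} (hb : 0 < b)
    (hmb : IntegrableOn (fun t => t ^ b * m t) (Ioi 0)) :
    IntegrableOn (fun s => s ^ (b - 1) * ∫ t in Ioi s, m t) (Ioi 0) ∧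
      ∫ s in Ioi 0, s ^ (b - 1) * ∫ t in Ioi s, m t = (∫ t in Ioi 0, t ^ b * m t) / b := by
  set ν := (volume.restrict (Ioi (0 : ℝ))).withDensity (fun t => ENNReal.ofReal (m t)) with hν
  have hmeas : AEMeasurable (fun t => ENNReal.ofReal (m t)) (volume.restrict (Ioi (0 : ℝ))) :=
    hm_int.aestronglyMeasurable.aemeasurable.ennreal_ofReal
  have hνpos : ∀ᵐ t ∂ν, 0 < t :=
    (withDensity_absolutelyContinuous _ _).ae_le (ae_restrict_mem measurableSet_Ioi)
  have hcake := lintegral_rpow_eq_lintegral_meas_lt_mul ν (f := fun t => t)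
    (hνpos.mono fun t ht => ht.le) aemeasurable_id hb
  have hpow : Measurable (fun t : ℝ => ENNReal.ofReal (t ^ b)) :=
    (measurable_id.pow_const b).ennreal_ofReal
  have hnonneg_b : 0 ≤ᵐ[volume.restrict (Ioi 0)] fun t => t ^ b * m t := by
    filter_upwards [ae_restrict_mem measurableSet_Ioi] with t ht
    have ht0 : 0 < t := ht
    exact mul_nonneg (by positivity) (hm_nonneg t ht)
  have hleft : ∫⁻ t, ENNReal.ofReal (t ^ b) ∂ν =
      ENNReal.ofReal (∫ t in Ioi 0, t ^ b * m t) := by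
    rw [hν, lintegral_withDensity_eq_lintegral_mul₀ hmeas hpow.aemeasurable,
      ofReal_integral_eq_lintegral_ofReal hmb hnonneg_b]
    refine setLIntegral_congr_fun measurableSet_Ioi fun t ht => ?_
    have ht0 : 0 < t := ht
    simp only [Pi.mul_apply]
    rw [mul_comm, ENNReal.ofReal_mul (by positivity)]
  have htail : ∀ s ∈ Ioi (0 : ℝ), ν {a | s < a} * ENNReal.ofReal (s ^ (b - 1)) =
      ENNReal.ofReal (s ^ (b - 1) * ∫ t in Ioi s, m t) := by
    intro s hs
    have hs0 : 0 < s := hs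
    have hset : {a : ℝ | s < a} = Ioi s := rfl
    rw [hset, hν, withDensity_apply _ measurableSet_Ioi,
      Measure.restrict_restrict measurableSet_Ioi,
      inter_eq_left.2 (Ioi_subset_Ioi hs0.le), ENNReal.ofReal_mul (by positivity), mul_comm,
      ofReal_integral_eq_lintegral_ofReal (hm_int.mono_set (Ioi_subset_Ioi hs0.le))]
    filter_upwards [ae_restrict_mem measurableSet_Ioi] with t ht
    exact hm_nonneg t (hs0.trans ht)
  rw [hleft, setLIntegral_congr_fun measurableSet_Ioi htail] at hcake
  have hsm : AEStronglyMeasurable (fun s => s ^ (b - 1) * ∫ t in Ioi s, m t)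
      (volume.restrict (Ioi 0)) :=
    (aestronglyMeasurable_rpow_restrict_Ioi _).mul
      (aemeasurable_restrict_of_antitoneOn measurableSet_Ioi
        (antitoneOn_tail_integral hm_nonneg hm_int)).aestronglyMeasurable
  have hnn : 0 ≤ᵐ[volume.restrict (Ioi 0)] fun s => s ^ (b - 1) * ∫ t in Ioi s, m t := by
    filter_upwards [ae_restrict_mem measurableSet_Ioi] with s hs
    have hs0 : 0 < s := hs
    exact mul_nonneg (by positivity) (tail_integral_nonneg hm_nonneg hs0.le)
  have h_int : IntegrableOn (fun s => s ^ (b - 1) * ∫ t in Ioi s, m t) (Ioi 0) := by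
    refine (lintegral_ofReal_ne_top_iff_integrable hsm hnn).1 fun htop => ?_
    rw [htop, ENNReal.mul_top (by simpa using hb)] at hcake
    exact ENNReal.ofReal_ne_top hcake
  refine ⟨h_int, ?_⟩
  rw [← ofReal_integral_eq_lintegral_ofReal h_int hnn, ← ENNReal.ofReal_mul hb.le,
    ENNReal.ofReal_eq_ofReal_iff (integral_nonneg_of_ae hnonneg_b)
      (mul_nonneg hb.le (integral_nonneg_of_ae hnn))] at hcake
  rw [hcake]
  field_simp

/-- Rescaled form of the moment formula for the tail integral. -/
lemma integral_rpow_mul_tail_comp_mul {m : ℝ → ℝ} (hm_nonneg : ∀ t > 0, 0 ≤ m t)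
    (hm_int : IntegrableOn m (Ioi 0)) {b : ℝ} (hb : 0 < b)
    (hmb : IntegrableOn (fun t => t ^ b * m t) (Ioi 0)) {γ : ℝ} (hγ : 0 < γ) :
    IntegrableOn (fun a => a ^ (b - 1) * ∫ t in Ioi (γ * a), m t) (Ioi 0) ∧
      ∫ a in Ioi 0, a ^ (b - 1) * ∫ t in Ioi (γ * a), m t =
        γ ^ (-b) * ((∫ t in Ioi 0, t ^ b * m t) / b) := by
  obtain ⟨h_int, heq⟩ := integral_rpow_mul_tail hm_nonneg hm_int hb hmb
  have hscale : ∀ a ∈ Ioi (0 : ℝ), γ ^ (1 - b) *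
      ((γ * a) ^ (b - 1) * ∫ t in Ioi (γ * a), m t) =
      a ^ (b - 1) * ∫ t in Ioi (γ * a), m t := by
    intro a ha
    have ha0 : 0 < a := ha
    rw [Real.mul_rpow hγ.le ha0.le, ← mul_assoc, ← mul_assoc, ← Real.rpow_add hγ]
    simp
  constructor
  · have h := (integrableOn_Ioi_comp_mul_left_iff
      (fun s => s ^ (b - 1) * ∫ t in Ioi s, m t) 0 hγ).2 (by rwa [mul_zero])
    exact IntegrableOn.congr_fun (h.const_mul (γ ^ (1 - b))) hscale measurableSet_Ioi
  · rw [← setIntegral_congr_fun measurableSet_Ioi hscale, integral_const_mul,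
      integral_comp_mul_left_Ioi (fun s => s ^ (b - 1) * ∫ t in Ioi s, m t) 0 hγ, mul_zero, heq,
      smul_eq_mul, ← mul_assoc]
    congr 1
    rw [← Real.rpow_neg_one γ, ← Real.rpow_add hγ]
    congr 1
    ring

/-- First-order expansion of the tail integral averaged against a gamma kernel. -/
lemma abs_integral_gamma_kernel_mul_tail_sub_le {m : ℝ → ℝ} (hm_nonneg : ∀ t > 0, 0 ≤ m t)
    (hm_int : IntegrableOn m (Ioi 0)) {b z : ℝ} (hb : 0 < b) (hz : 0 < z)
    (hmb : IntegrableOn (fun t => t ^ b * m t) (Ioi 0))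
    (hmb' : IntegrableOn (fun t => t ^ (b + 1) * m t) (Ioi 0)) {γ : ℝ} (hγ : 0 < γ) :
    IntegrableOn (fun a => a ^ (b - 1) * Real.exp (-z * a) * ∫ t in Ioi (γ * a), m t) (Ioi 0) ∧
      |(∫ a in Ioi 0, a ^ (b - 1) * Real.exp (-z * a) * ∫ t in Ioi (γ * a), m t) -
        γ ^ (-b) * ((∫ t in Ioi 0, t ^ b * m t) / b)| ≤
      z * (γ ^ (-(b + 1)) * ((∫ t in Ioi 0, t ^ (b + 1) * m t) / (b + 1))) := by
  obtain ⟨hi, he⟩ := integral_rpow_mul_tail_comp_mul hm_nonneg hm_int hb hmb hγ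
  obtain ⟨hi', he'⟩ := integral_rpow_mul_tail_comp_mul hm_nonneg hm_int (b := b + 1)
    (by linarith) hmb' hγ
  have hcont : Continuous fun a : ℝ => Real.exp (-z * a) := by fun_prop
  have h_int : IntegrableOn
      (fun a => a ^ (b - 1) * Real.exp (-z * a) * ∫ t in Ioi (γ * a), m t) (Ioi 0) := by
    have h : IntegrableOn (fun a => Real.exp (-z * a) *
        (a ^ (b - 1) * ∫ t in Ioi (γ * a), m t)) (Ioi 0) := by
      refine Integrable.bdd_mul (c := 1) hi hcont.aestronglyMeasurable ?_
      filter_upwards [ae_restrict_mem measurableSet_Ioi] with a ha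
      have ha0 : 0 < a := ha
      rw [Real.norm_of_nonneg (Real.exp_pos _).le]
      exact Real.exp_le_one_iff.2 (by nlinarith)
    exact h.congr_fun (fun a _ => by ring) measurableSet_Ioi
  refine ⟨h_int, ?_⟩
  rw [← he, ← he', ← integral_sub h_int hi, ← integral_const_mul, ← Real.norm_eq_abs]
  refine norm_integral_le_of_norm_le (hi'.const_mul z) ?_
  filter_upwards [ae_restrict_mem measurableSet_Ioi] with a ha
  have ha0 : 0 < a := ha
  have hT : 0 ≤ ∫ t in Ioi (γ * a), m t := tail_integral_nonneg hm_nonneg (by positivity)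
  have hexp1 : Real.exp (-z * a) ≤ 1 := Real.exp_le_one_iff.2 (by nlinarith)
  have hexp2 : 1 - z * a ≤ Real.exp (-z * a) := by
    linarith [Real.add_one_le_exp (-z * a)]
  have hpow : a ^ (b + 1 - 1) = a ^ (b - 1) * a := by
    rw [← Real.rpow_add_one ha0.ne']
    congr 1
    ring
  rw [hpow, show a ^ (b - 1) * Real.exp (-z * a) * (∫ t in Ioi (γ * a), m t) -
    a ^ (b - 1) * (∫ t in Ioi (γ * a), m t) =
    -((1 - Real.exp (-z * a)) * (a ^ (b - 1) * ∫ t in Ioi (γ * a), m t)) by ring, norm_neg,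
    Real.norm_of_nonneg (mul_nonneg (by linarith) (by positivity))]
  calc (1 - Real.exp (-z * a)) * (a ^ (b - 1) * ∫ t in Ioi (γ * a), m t)
      ≤ (z * a) * (a ^ (b - 1) * ∫ t in Ioi (γ * a), m t) := by
        gcongr
        linarith
    _ = _ := by ring

/-- A gamma kernel whose exponent is either `b₀` or at least `b₀ + 1` contributes, up to
`O(γ ^ (-b₀ - 1))`, only in the first case. -/
lemma exists_abs_integral_gamma_kernel_mul_tail_le {m : ℝ → ℝ} (hm_nonneg : ∀ t > 0, 0 ≤ m t)
    (hm_int : ∀ b : ℝ, 0 ≤ b → IntegrableOn (fun t => t ^ b * m t) (Ioi 0))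
    {b b₀ z : ℝ} (hb : 0 < b) (hz : 0 < z) (hbb : b = b₀ ∨ b₀ + 1 ≤ b) :
    ∃ K, 0 ≤ K ∧ ∀ γ ≥ 1,
      |(∫ a in Ioi 0, a ^ (b - 1) * Real.exp (-z * a) * ∫ t in Ioi (γ * a), m t) -
        (if b = b₀ then γ ^ (-b₀) * ((∫ t in Ioi 0, t ^ b₀ * m t) / b₀) else 0)| ≤
      K * γ ^ (-b₀ - 1) := by
  have h_int : IntegrableOn m (Ioi 0) := by simpa using hm_int 0 le_rfl
  have hmom : ∀ x : ℝ, 0 ≤ ∫ t in Ioi 0, t ^ x * m t := fun x =>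
    setIntegral_nonneg measurableSet_Ioi fun t ht =>
      mul_nonneg (Real.rpow_nonneg (le_of_lt ht) _) (hm_nonneg t ht)
  set P := (∫ t in Ioi 0, t ^ b * m t) / b
  set Q := (∫ t in Ioi 0, t ^ (b + 1) * m t) / (b + 1)
  have hP : 0 ≤ P := div_nonneg (hmom b) hb.le
  have hQ : 0 ≤ Q := div_nonneg (hmom _) (by linarith)
  refine ⟨P + z * Q, by positivity, fun γ hγ => ?_⟩
  have hγ0 : 0 < γ := by linarith
  have hle := (abs_integral_gamma_kernel_mul_tail_sub_le hm_nonneg h_int hb hz (hm_int b hb.le)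
    (hm_int (b + 1) (by linarith)) hγ0).2
  have hG : 0 < γ ^ (-b₀ - 1) := by positivity
  have hmono : γ ^ (-(b + 1)) ≤ γ ^ (-b₀ - 1) := by
    apply Real.rpow_le_rpow_of_exponent_le hγ
    rcases hbb with h | h <;> linarith
  have hsecond : z * (γ ^ (-(b + 1)) * Q) ≤ z * (γ ^ (-b₀ - 1) * Q) := by gcongr
  by_cases h : b = b₀
  · subst h
    rw [if_pos rfl]
    refine hle.trans (hsecond.trans ?_)
    nlinarith [mul_nonneg hP hG.le]
  · have hb1 : b₀ + 1 ≤ b := hbb.resolve_left h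
    have hfirst : γ ^ (-b) * P ≤ γ ^ (-b₀ - 1) * P := by
      gcongr
      linarith
    have hnn : 0 ≤ γ ^ (-b) * P := by positivity
    rw [if_neg h, sub_zero]
    rw [abs_le] at hle ⊢
    constructor <;> nlinarith [hle.1, hle.2]

lemma eq_or_add_one_le_of_gap {L : ℕ} {β : ℕ → ℝ}
    (hgap : ∀ l, l + 1 < L → β (l + 1) = β l ∨ β l + 1 ≤ β (l + 1)) :
    ∀ l < L, β l = β 0 ∨ β 0 + 1 ≤ β l := by
  intro l
  induction l with
  | zero => exact fun _ => Or.inl rfl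
  | succ k ih =>
    intro hk
    rcases hgap k hk with h | h <;> rcases ih (by omega) with h' | h'
    · exact Or.inl (h.trans h')
    · exact Or.inr (h ▸ h')
    · exact Or.inr (h' ▸ h)
    · exact Or.inr (by linarith)

lemma integral_gamma_kernel {b z : ℝ} (hb : 0 < b) (hz : 0 < z) :
    IntegrableOn (fun a => a ^ (b - 1) * Real.exp (-z * a)) (Ioi 0) ∧
      ∫ a in Ioi 0, a ^ (b - 1) * Real.exp (-z * a) = Real.Gamma b * z ^ (-b) := by
  constructor
  · simpa using integrableOn_rpow_mul_exp_neg_mul_rpow (show -1 < b - 1 by linarith) one_pos hz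
  · have h := Real.integral_rpow_mul_exp_neg_mul_Ioi hb hz
    rw [one_div, Real.inv_rpow hz.le, ← Real.rpow_neg hz.le, mul_comm] at h
    simpa only [neg_mul] using h

/-- For a mixture gamma density `f` and an MMSE-type function `m`,
the average mutual information `Ī(γ̄) = ∫_0^∞ f(a) I(γ̄ a) da` satisfies, as `γ̄ → ∞`,
`Ī(γ̄) = I_∞ − G_a γ̄^{−β₁} + O(γ̄^{−β₁−1})`, where
`G_a = (1/β₁)(Σ_{l : β_l = β₁} α_l) M̂(β₁)`, and `0 < G_a < ∞`. -/
theorem asymptotic_AMI_mixture_gamma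
    (L : ℕ) (hL : 0 < L) (α β ζ : ℕ → ℝ)
    (hα : ∀ l < L, 0 < α l) (hβ : ∀ l < L, 0 < β l) (hζ : ∀ l < L, 0 < ζ l)
    (hmono : ∀ l, l + 1 < L → β l ≤ β (l + 1))
    (hgap : ∀ l, l + 1 < L → β (l + 1) = β l ∨ β l + 1 ≤ β (l + 1))
    (hnorm : ∑ l ∈ Finset.range L, α l * Real.Gamma (β l) * (ζ l) ^ (-(β l)) = 1)
    (f : ℝ → ℝ)
    (hf : ∀ a > 0, f a = ∑ l ∈ Finset.range L, α l * a ^ (β l - 1) * Real.exp (-(ζ l) * a))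
    (m : ℝ → ℝ)
    (hm_cont : ContinuousOn m (Set.Ioi 0))
    (hm_pos : ∀ t > 0, 0 < m t)
    (hm_lim : Tendsto m (nhdsWithin 0 (Set.Ioi 0)) (nhds 1))
    (hm_decay : ∃ C > 0, ∃ c > 0, ∀ t ≥ 1, m t ≤ C * t ^ (-(1 : ℝ) / 2) * Real.exp (-c * t))
    (I : ℝ → ℝ) (hI : ∀ γ ≥ 0, I γ = ∫ t in Set.Ioc 0 γ, m t)
    (Iinf : ℝ) (hIinf : Iinf = ∫ t in Set.Ioi 0, m t)
    (Mhat : ℝ → ℝ) (hMhat : ∀ x > 0, Mhat x = ∫ t in Set.Ioi 0, t ^ x * m t)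
    (Ibar : ℝ → ℝ) (hIbar : ∀ γ > 0, Ibar γ = ∫ a in Set.Ioi 0, f a * I (γ * a))
    (Ga : ℝ)
    (hGa : Ga = (1 / β 0) *
      (∑ l ∈ (Finset.range L).filter (fun l => β l = β 0), α l) * Mhat (β 0)) :
    -- `M̂(β₁)` is given by a convergent integral (so that `G_a < ∞`), `G_a > 0`,
    -- and the asymptotic expansion with explicit error bound holds:
    MeasureTheory.IntegrableOn (fun t => t ^ (β 0) * m t) (Set.Ioi 0) ∧
    0 < Ga ∧
    ∃ C' > 0, ∃ γ0 > 0, ∀ γ ≥ γ0,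
      |Ibar γ - Iinf + Ga * γ ^ (-(β 0))| ≤ C' * γ ^ (-(β 0) - 1) := by
  obtain ⟨C, hC, c, hc, hdecay⟩ := hm_decay
  obtain ⟨D, -, hD⟩ := exists_le_mul_exp_neg hm_cont hm_lim hC hc fun t ht => by
    refine (hdecay t ht).trans ?_
    gcongr
    exact mul_le_of_le_one_right hC.le (Real.rpow_le_one_of_one_le_of_nonpos ht (by norm_num))
  have hnn : ∀ t > 0, 0 ≤ m t := fun t ht => (hm_pos t ht).le
  have hmom : ∀ b : ℝ, 0 ≤ b → IntegrableOn (fun t => t ^ b * m t) (Ioi 0) := fun b hb =>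
    integrableOn_rpow_mul_of_le_exp hm_cont hnn hc hD (by linarith)
  have h_int : IntegrableOn m (Ioi 0) := by simpa using hmom 0 le_rfl
  have hβ0 : 0 < β 0 := hβ 0 hL
  refine ⟨hmom _ hβ0.le, ?_, ?_⟩
  · have hM : 0 < Mhat (β 0) := by
      have hpos : ∀ t ∈ Ioi (0 : ℝ), 0 < t ^ (β 0) * m t := fun t ht =>
        mul_pos (Real.rpow_pos_of_pos ht _) (hm_pos t ht)
      rw [hMhat _ hβ0, setIntegral_pos_iff_support_of_nonneg_ae
        (by filter_upwards [ae_restrict_mem measurableSet_Ioi] with t ht using (hpos t ht).le)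
        (hmom _ hβ0.le),
        inter_eq_right.2 fun t ht => Function.mem_support.2 (hpos t ht).ne']
      simp
    have hS : 0 < ∑ l ∈ (Finset.range L).filter (fun l => β l = β 0), α l :=
      Finset.sum_pos (fun l hl => hα l (Finset.mem_range.1 (Finset.mem_filter.1 hl).1))
        ⟨0, by simp [hL]⟩
    rw [hGa]
    positivity
  · have hK : ∀ l, ∃ K, 0 ≤ K ∧ (l < L → ∀ γ ≥ 1,
        |(∫ a in Ioi 0, a ^ (β l - 1) * Real.exp (-ζ l * a) * ∫ t in Ioi (γ * a), m t) -
          (if β l = β 0 then γ ^ (-β 0) * ((∫ t in Ioi 0, t ^ β 0 * m t) / β 0) else 0)| ≤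
        K * γ ^ (-β 0 - 1)) := by
      intro l
      by_cases hl : l < L
      · obtain ⟨K, hK0, hK⟩ := exists_abs_integral_gamma_kernel_mul_tail_le hnn hmom (hβ l hl)
          (hζ l hl) (eq_or_add_one_le_of_gap hgap l hl)
        exact ⟨K, hK0, fun _ => hK⟩
      · exact ⟨0, le_rfl, fun h => absurd h hl⟩
    choose K hK0 hK using hK
    have hsum0 : 0 ≤ ∑ l ∈ Finset.range L, α l * K l :=
      Finset.sum_nonneg fun l hl => mul_nonneg (hα l (Finset.mem_range.1 hl)).le (hK0 l)
    refine ⟨∑ l ∈ Finset.range L, α l * K l + 1, by linarith, 1, one_pos, fun γ hγ => ?_⟩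
    have hγ0 : 0 < γ := by linarith
    have hpt : ∀ a ∈ Ioi (0 : ℝ), f a * I (γ * a) =
        ∑ l ∈ Finset.range L, (α l * Iinf * (a ^ (β l - 1) * Real.exp (-ζ l * a)) -
          α l * (a ^ (β l - 1) * Real.exp (-ζ l * a) * ∫ t in Ioi (γ * a), m t)) := by
      intro a ha
      have hγa : 0 < γ * a := mul_pos hγ0 ha
      have hsplit : I (γ * a) = Iinf - ∫ t in Ioi (γ * a), m t := by
        rw [hI _ hγa.le, hIinf, ← Ioc_union_Ioi_eq_Ioi hγa.le,
          setIntegral_union Ioc_disjoint_Ioi_same measurableSet_Ioi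
            (h_int.mono_set Ioc_subset_Ioi_self) (h_int.mono_set (Ioi_subset_Ioi hγa.le))]
        ring
      rw [hf a ha, hsplit, Finset.sum_mul]
      exact Finset.sum_congr rfl fun l _ => by ring
    have hker : ∀ l ∈ Finset.range L, IntegrableOn (fun a =>
        a ^ (β l - 1) * Real.exp (-ζ l * a) * ∫ t in Ioi (γ * a), m t) (Ioi 0) := fun l hl => by
      have hl' := Finset.mem_range.1 hl
      exact (abs_integral_gamma_kernel_mul_tail_sub_le hnn h_int (hβ l hl') (hζ l hl')
        (hmom _ (hβ l hl').le) (hmom _ (by linarith [hβ l hl'])) hγ0).1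
    have hgam : ∀ l ∈ Finset.range L,
        IntegrableOn (fun a => a ^ (β l - 1) * Real.exp (-ζ l * a)) (Ioi 0) ∧
        ∫ a in Ioi 0, a ^ (β l - 1) * Real.exp (-ζ l * a) =
          Real.Gamma (β l) * ζ l ^ (-β l) := fun l hl =>
      integral_gamma_kernel (hβ l (Finset.mem_range.1 hl)) (hζ l (Finset.mem_range.1 hl))
    have hIb : Ibar γ = Iinf - ∑ l ∈ Finset.range L, α l *
        ∫ a in Ioi 0, a ^ (β l - 1) * Real.exp (-ζ l * a) * ∫ t in Ioi (γ * a), m t := by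
      rw [hIbar γ hγ0, setIntegral_congr_fun measurableSet_Ioi hpt]
      refine (integral_finsetSum _ fun l hl =>
        ((hgam l hl).1.const_mul (α l * Iinf)).sub ((hker l hl).const_mul (α l))).trans ?_
      have hone : Iinf = ∑ l ∈ Finset.range L,
          α l * Iinf * (Real.Gamma (β l) * ζ l ^ (-β l)) := by
        refine (mul_one Iinf).symm.trans ?_
        rw [← hnorm, Finset.mul_sum]
        exact Finset.sum_congr rfl fun l _ => by ring
      refine Eq.trans ?_ (congrArg (· - _) hone).symm
      rw [← Finset.sum_sub_distrib]
      refine Finset.sum_congr rfl fun l hl => ?_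
      simp only [Pi.sub_apply]
      rw [integral_sub ((hgam l hl).1.const_mul _) ((hker l hl).const_mul _),
        integral_const_mul, integral_const_mul, (hgam l hl).2]
    have hGaγ : Ga * γ ^ (-β 0) = ∑ l ∈ Finset.range L, α l *
        (if β l = β 0 then γ ^ (-β 0) * ((∫ t in Ioi 0, t ^ β 0 * m t) / β 0) else 0) := by
      simp only [mul_ite, mul_zero]
      rw [hGa, hMhat _ hβ0, ← Finset.sum_filter, ← Finset.sum_mul]
      ring
    have hdiff : Ibar γ - Iinf + Ga * γ ^ (-β 0) = -∑ l ∈ Finset.range L, α l *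
        ((∫ a in Ioi 0, a ^ (β l - 1) * Real.exp (-ζ l * a) * ∫ t in Ioi (γ * a), m t) -
          (if β l = β 0 then γ ^ (-β 0) * ((∫ t in Ioi 0, t ^ β 0 * m t) / β 0) else 0)) := by
      simp only [mul_sub, Finset.sum_sub_distrib]
      rw [hIb, hGaγ]
      ring
    rw [hdiff, abs_neg]
    calc _ ≤ ∑ l ∈ Finset.range L, α l * (K l * γ ^ (-β 0 - 1)) := by
          refine (Finset.abs_sum_le_sum_abs _ _).trans (Finset.sum_le_sum fun l hl => ?_)
          have hl' := Finset.mem_range.1 hl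
          rw [abs_mul, abs_of_pos (hα l hl')]
          exact mul_le_mul_of_nonneg_left (hK l hl' γ hγ) (hα l hl').le
      _ = (∑ l ∈ Finset.range L, α l * K l) * γ ^ (-β 0 - 1) := by
          rw [Finset.sum_mul]
          exact Finset.sum_congr rfl fun l _ => by ring
      _ ≤ _ := by
          gcongr
          linarith
end

section
/- Let f be a mixture gamma density with parameters L, {α_l}, {β_l}, {ζ_l}, and let g : [0,∞) → ℝ be continuously differentiable, nondecreasing, with g(0) = 0 and g(t) → G as t → ∞ for some finite G. Then for every γ̄ > 0, ∫_0^∞ f(a) g(γ̄ a) da = G − Σ_{l=1}^L α_l ζ_l^{−β_l} ∫_0^∞ Υ(β_l, ζ_l t/γ̄) g′(t) dt, and all integrals appearing are finite. -/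
open MeasureTheory Real Filter Set

/-- Lower incomplete gamma function `Υ(s, x) = ∫_0^x t^{s−1} e^{−t} dt`. -/
noncomputable def lowerGamma (s x : ℝ) : ℝ := ∫ t in (0 : ℝ)..x, t ^ (s - 1) * Real.exp (-t)

theorem integrableOn_rpow_mul_exp_neg {s : ℝ} (hs : 0 < s) :
    IntegrableOn (fun t : ℝ => t ^ (s - 1) * Real.exp (-t)) (Set.Ioi 0) := by
  simpa only [mul_comm] using Real.GammaIntegral_convergent hs

theorem lowerGamma_tendsto_atTop {s : ℝ} (hs : 0 < s) :
    Tendsto (lowerGamma s) atTop (nhds (Real.Gamma s)) := by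
  have h := intervalIntegral_tendsto_integral_Ioi 0 (integrableOn_rpow_mul_exp_neg hs) tendsto_id
  rw [Real.Gamma_eq_integral hs]
  simpa only [lowerGamma, mul_comm, id] using! h

theorem abs_lowerGamma_le {s x : ℝ} (hs : 0 < s) (hx : 0 ≤ x) :
    |lowerGamma s x| ≤ Real.Gamma s := by
  have hnonneg : ∀ t ∈ Set.Ioi (0 : ℝ), 0 ≤ t ^ (s - 1) * Real.exp (-t) := fun t ht =>
    mul_nonneg (Real.rpow_nonneg (le_of_lt ht) _) (Real.exp_pos _).le
  have hG : Real.Gamma s = ∫ t in Set.Ioi (0 : ℝ), t ^ (s - 1) * Real.exp (-t) := by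
    simpa only [mul_comm] using Real.Gamma_eq_integral hs
  rw [lowerGamma, intervalIntegral.integral_of_le hx, hG, abs_of_nonneg]
  · exact setIntegral_mono_set (integrableOn_rpow_mul_exp_neg hs)
      (ae_restrict_of_forall_mem measurableSet_Ioi hnonneg) Ioc_subset_Ioi_self.eventuallyLE
  · exact setIntegral_nonneg measurableSet_Ioc fun t ht => hnonneg t ht.1

theorem hasDerivAt_lowerGamma {s x : ℝ} (hs : 0 < s) (hx : 0 < x) :
    HasDerivAt (lowerGamma s) (x ^ (s - 1) * Real.exp (-x)) x := by
  have hc : ContinuousOn (fun t : ℝ => t ^ (s - 1) * Real.exp (-t)) (Set.Ioi 0) := fun t ht =>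
    ((Real.continuousAt_rpow_const t _ (Or.inl (ne_of_gt ht))).mul
      (by fun_prop)).continuousWithinAt
  refine intervalIntegral.integral_hasDerivAt_right ?_
    (hc.stronglyMeasurableAtFilter isOpen_Ioi x hx) (hc.continuousAt (Ioi_mem_nhds hx))
  rw [intervalIntegrable_iff_integrableOn_Ioc_of_le hx.le]
  exact (integrableOn_rpow_mul_exp_neg hs).mono_set Ioc_subset_Ioi_self

/-- Integration by parts against a single gamma kernel. -/
theorem gamma_kernel_integral_by_parts {s z γ G : ℝ} {g g' : ℝ → ℝ}
    (hs : 0 < s) (hz : 0 < z) (hγ : 0 < γ)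
    (hg_deriv : ∀ t ≥ (0 : ℝ), HasDerivAt g (g' t) t)
    (hg_mono : MonotoneOn g (Set.Ici 0)) (hg0 : g 0 = 0) (hg_lim : Tendsto g atTop (nhds G)) :
    IntegrableOn (fun a => a ^ (s - 1) * Real.exp (-z * a) * g (γ * a)) (Set.Ioi 0) ∧
    IntegrableOn (fun t => lowerGamma s (z * t / γ) * g' t) (Set.Ioi 0) ∧
    ∫ a in Set.Ioi 0, a ^ (s - 1) * Real.exp (-z * a) * g (γ * a) =
      z ^ (-s) * (Real.Gamma s * G - ∫ t in Set.Ioi 0, lowerGamma s (z * t / γ) * g' t) := by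
  have hg'_nonneg : ∀ t ∈ Set.Ioi (0 : ℝ), 0 ≤ g' t := fun t ht => by
    have hd := (hg_deriv t (le_of_lt ht)).hasDerivWithinAt (s := Set.Ici 0)
    rw [← hd.derivWithin ((uniqueDiffOn_Ici 0) t (Ioi_subset_Ici_self ht))]
    exact hg_mono.derivWithin_nonneg
  have hg'_int : IntegrableOn g' (Set.Ioi 0) :=
    integrableOn_Ioi_deriv_of_nonneg' hg_deriv hg'_nonneg hg_lim
  have hg_le : ∀ t ∈ Set.Ioi (0 : ℝ), ‖g t‖ ≤ G := fun t ht => by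
    have h0 : 0 ≤ g t := hg0 ▸ hg_mono self_mem_Ici (Ioi_subset_Ici_self ht) (le_of_lt ht)
    rw [Real.norm_eq_abs, abs_of_nonneg h0]
    refine ge_of_tendsto hg_lim ?_
    filter_upwards [eventually_ge_atTop t] with x hx
    exact hg_mono (Ioi_subset_Ici_self ht) (mem_Ici.2 (le_trans (le_of_lt ht) hx)) hx
  have hpos : ∀ t ∈ Set.Ioi (0 : ℝ), 0 < z * t / γ := fun t ht => div_pos (mul_pos hz ht) hγ
  have hu_deriv : ∀ t ∈ Set.Ioi (0 : ℝ), HasDerivAt (fun t => lowerGamma s (z * t / γ))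
      ((z * t / γ) ^ (s - 1) * Real.exp (-(z * t / γ)) * (z / γ)) t := fun t ht => by
    have hlin : HasDerivAt (fun t => z * t / γ) (z / γ) t := by
      simpa using ((hasDerivAt_id t).const_mul z).div_const γ
    exact (hasDerivAt_lowerGamma hs (hpos t ht)).comp t hlin
  have hu_le : ∀ t ∈ Set.Ioi (0 : ℝ), ‖lowerGamma s (z * t / γ)‖ ≤ Real.Gamma s := fun t ht =>
    abs_lowerGamma_le hs (hpos t ht).le
  have hu_meas : AEStronglyMeasurable (fun t => lowerGamma s (z * t / γ))
      (volume.restrict (Set.Ioi 0)) :=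
    ContinuousOn.aestronglyMeasurable
      (fun t ht => (hu_deriv t ht).continuousAt.continuousWithinAt) measurableSet_Ioi
  have hg_meas : AEStronglyMeasurable g (volume.restrict (Set.Ioi 0)) :=
    ContinuousOn.aestronglyMeasurable
      (fun t ht => (hg_deriv t (le_of_lt ht)).continuousAt.continuousWithinAt) measurableSet_Ioi
  have huv' : IntegrableOn (fun t => lowerGamma s (z * t / γ) * g' t) (Set.Ioi 0) :=
    Integrable.bdd_mul hg'_int hu_meas (ae_restrict_of_forall_mem measurableSet_Ioi hu_le)
  have hu'_int : IntegrableOn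
      (fun t => (z * t / γ) ^ (s - 1) * Real.exp (-(z * t / γ)) * (z / γ)) (Set.Ioi 0) := by
    have h := (integrableOn_Ioi_comp_mul_left_iff
      (fun t : ℝ => t ^ (s - 1) * Real.exp (-t)) 0 (div_pos hz hγ)).2
        (by simpa using integrableOn_rpow_mul_exp_neg hs)
    simpa only [div_mul_eq_mul_div] using! h.mul_const (z / γ)
  have hu'v : IntegrableOn
      (fun t => (z * t / γ) ^ (s - 1) * Real.exp (-(z * t / γ)) * (z / γ) * g t) (Set.Ioi 0) :=
    Integrable.mul_bdd hu'_int hg_meas (ae_restrict_of_forall_mem measurableSet_Ioi hg_le)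
  have hzero : Tendsto (fun t => lowerGamma s (z * t / γ) * g t)
      (nhdsWithin 0 (Set.Ioi 0)) (nhds 0) := by
    refine bdd_le_mul_tendsto_zero' (Real.Gamma s) ?_ ?_
    · filter_upwards [self_mem_nhdsWithin] with t ht using hu_le t ht
    · simpa [hg0] using (hg_deriv 0 le_rfl).continuousAt.tendsto.mono_left nhdsWithin_le_nhds
  have htop : Tendsto (fun t => lowerGamma s (z * t / γ) * g t) atTop
      (nhds (Real.Gamma s * G)) :=
    ((lowerGamma_tendsto_atTop hs).comp
      ((tendsto_id.const_mul_atTop hz).atTop_div_const hγ)).mul hg_lim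
  have hparts := integral_Ioi_mul_deriv_eq_deriv_mul hu_deriv
    (fun t ht => hg_deriv t (le_of_lt ht)) huv' hu'v hzero htop
  have hscale : ∀ a ∈ Set.Ioi (0 : ℝ),
      a ^ (s - 1) * Real.exp (-z * a) * g (γ * a) =
        γ * z ^ (-s) * ((z * (γ * a) / γ) ^ (s - 1) * Real.exp (-(z * (γ * a) / γ)) * (z / γ) *
          g (γ * a)) := fun a ha => by
    have h1 : z * (γ * a) / γ = z * a := by field_simp
    have h2 : z ^ (-s) * z ^ (s - 1) * z = 1 := by
      rw [← Real.rpow_add hz, ← Real.rpow_add_one hz.ne',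
        show -s + (s - 1) + 1 = 0 by ring, Real.rpow_zero]
    have h3 : γ * (z / γ) = z := mul_div_cancel₀ z hγ.ne'
    rw [h1, Real.mul_rpow hz.le (le_of_lt ha), neg_mul]
    linear_combination (-(a ^ (s - 1) * Real.exp (-(z * a)) * g (γ * a))) * h2 -
      z ^ (-s) * z ^ (s - 1) * (a ^ (s - 1) * Real.exp (-(z * a)) * g (γ * a)) * h3
  have hcomp := (integrableOn_Ioi_comp_mul_left_iff
    (fun t => (z * t / γ) ^ (s - 1) * Real.exp (-(z * t / γ)) * (z / γ) * g t) 0 hγ).2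
      (by simpa using hu'v)
  refine ⟨?_, huv', ?_⟩
  · exact IntegrableOn.congr_fun (hcomp.const_mul (γ * z ^ (-s)))
      (fun a ha => (hscale a ha).symm) measurableSet_Ioi
  · rw [setIntegral_congr_fun measurableSet_Ioi hscale, integral_const_mul,
      integral_comp_mul_left_Ioi
        (fun t => (z * t / γ) ^ (s - 1) * Real.exp (-(z * t / γ)) * (z / γ) * g t) 0 hγ,
      mul_zero, smul_eq_mul, hparts]
    field_simp
    ring

/-- For a mixture gamma density `f` and a continuously differentiable,
nondecreasing `g : [0,∞) → ℝ` with `g(0) = 0` and `g(t) → G`, for every `γ̄ > 0`: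
`∫_0^∞ f(a) g(γ̄ a) da = G − Σ_l α_l ζ_l^{−β_l} ∫_0^∞ Υ(β_l, ζ_l t/γ̄) g′(t) dt`,
and all integrals appearing are finite. -/
theorem AMI_integration_by_parts
    (L : ℕ) (hL : 0 < L) (α β ζ : ℕ → ℝ)
    (hα : ∀ l < L, 0 < α l) (hβ : ∀ l < L, 0 < β l) (hζ : ∀ l < L, 0 < ζ l)
    (hmono : ∀ l, l + 1 < L → β l ≤ β (l + 1))
    (hgap : ∀ l, l + 1 < L → β (l + 1) = β l ∨ β l + 1 ≤ β (l + 1))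
    (hnorm : ∑ l ∈ Finset.range L, α l * Real.Gamma (β l) * (ζ l) ^ (-(β l)) = 1)
    (f : ℝ → ℝ)
    (hf : ∀ a > 0, f a = ∑ l ∈ Finset.range L, α l * a ^ (β l - 1) * Real.exp (-(ζ l) * a))
    (g g' : ℝ → ℝ) (G : ℝ)
    (hg_deriv : ∀ t ≥ (0 : ℝ), HasDerivAt g (g' t) t)
    (hg'_cont : ContinuousOn g' (Set.Ici 0))
    (hg_mono : MonotoneOn g (Set.Ici 0))
    (hg0 : g 0 = 0)
    (hg_lim : Tendsto g atTop (nhds G)) :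
    ∀ γ > (0 : ℝ),
      MeasureTheory.IntegrableOn (fun a => f a * g (γ * a)) (Set.Ioi 0) ∧
      (∀ l < L, MeasureTheory.IntegrableOn
        (fun t => lowerGamma (β l) (ζ l * t / γ) * g' t) (Set.Ioi 0)) ∧
      (∫ a in Set.Ioi 0, f a * g (γ * a)) =
        G - ∑ l ∈ Finset.range L, α l * (ζ l) ^ (-(β l)) *
          ∫ t in Set.Ioi 0, lowerGamma (β l) (ζ l * t / γ) * g' t := by
  intro γ hγ
  have key := fun l (hl : l < L) => gamma_kernel_integral_by_parts (hβ l hl) (hζ l hl) hγ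
    hg_deriv hg_mono hg0 hg_lim
  have hfg : ∀ a ∈ Set.Ioi (0 : ℝ), f a * g (γ * a) = ∑ l ∈ Finset.range L,
      α l * (a ^ (β l - 1) * Real.exp (-(ζ l) * a) * g (γ * a)) := fun a ha => by
    rw [hf a ha, Finset.sum_mul]
    exact Finset.sum_congr rfl fun l _ => by ring
  have hint : ∀ l ∈ Finset.range L, IntegrableOn
      (fun a => α l * (a ^ (β l - 1) * Real.exp (-(ζ l) * a) * g (γ * a))) (Set.Ioi 0) :=
    fun l hl => (key l (Finset.mem_range.1 hl)).1.const_mul _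
  refine ⟨?_, fun l hl => (key l hl).2.1, ?_⟩
  · exact IntegrableOn.congr_fun (integrable_finsetSum _ hint)
      (fun a ha => (hfg a ha).symm) measurableSet_Ioi
  · rw [setIntegral_congr_fun measurableSet_Ioi hfg, integral_finsetSum _ hint]
    have hG : G = ∑ l ∈ Finset.range L, α l * Real.Gamma (β l) * (ζ l) ^ (-(β l)) * G := by
      rw [← Finset.sum_mul, hnorm, one_mul]
    nth_rewrite 1 [hG]
    rw [← Finset.sum_sub_distrib]
    refine Finset.sum_congr rfl fun l hl => ?_
    rw [integral_const_mul, (key l (Finset.mem_range.1 hl)).2.2]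
    ring
end

section
/- Let β > 0, ζ > 0, and let m : (0,∞) → [0,∞) be measurable with ∫_0^∞ t^β m(t) dt < ∞ and ∫_0^∞ t^{β+1} m(t) dt < ∞. Then for every γ̄ > 0, | ζ^{−β} ∫_0^∞ Υ(β, ζ t/γ̄) m(t) dt − γ̄^{−β} β^{−1} ∫_0^∞ t^β m(t) dt | ≤ ζ γ̄^{−β−1} (β+1)^{−1} ∫_0^∞ t^{β+1} m(t) dt. -/
open MeasureTheory Real Set

theorem intervalIntegrable_lowerGamma_integrand {s : ℝ} (hs : 0 < s) (a b : ℝ) :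
    IntervalIntegrable (fun t : ℝ => t ^ (s - 1) * Real.exp (-t)) volume a b :=
  (intervalIntegral.intervalIntegrable_rpow' (by linarith)).mul_continuousOn
    (Real.continuous_exp.comp continuous_neg).continuousOn

theorem continuous_lowerGamma {s : ℝ} (hs : 0 < s) : Continuous (lowerGamma s) :=
  intervalIntegral.continuous_primitive (intervalIntegrable_lowerGamma_integrand hs) 0

theorem integral_rpow_sub_one {s : ℝ} (hs : 0 < s) (x : ℝ) :
    ∫ t in (0 : ℝ)..x, t ^ (s - 1) = x ^ s / s := by
  rw [integral_rpow (Or.inl (by linarith)), sub_add_cancel, zero_rpow hs.ne', sub_zero]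

theorem lowerGamma_nonneg (s : ℝ) {x : ℝ} (hx : 0 ≤ x) : 0 ≤ lowerGamma s x :=
  intervalIntegral.integral_nonneg hx fun _ ht =>
    mul_nonneg (rpow_nonneg ht.1 _) (Real.exp_pos _).le

theorem lowerGamma_le {s x : ℝ} (hs : 0 < s) (hx : 0 ≤ x) : lowerGamma s x ≤ x ^ s / s := by
  rw [← integral_rpow_sub_one hs]
  refine intervalIntegral.integral_mono_on hx (intervalIntegrable_lowerGamma_integrand hs 0 x)
    (intervalIntegral.intervalIntegrable_rpow' (by linarith)) fun t ht => ?_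
  exact mul_le_of_le_one_right (rpow_nonneg ht.1 _) (Real.exp_le_one_iff.2 (by linarith [ht.1]))

theorem sub_le_lowerGamma {s x : ℝ} (hs : 0 < s) (hx : 0 ≤ x) :
    x ^ s / s - x ^ (s + 1) / (s + 1) ≤ lowerGamma s x := by
  have h₁ : IntervalIntegrable (fun t : ℝ => t ^ (s - 1)) volume 0 x :=
    intervalIntegral.intervalIntegrable_rpow' (by linarith)
  have h₂ : IntervalIntegrable (fun t : ℝ => t ^ (s + 1 - 1)) volume 0 x :=
    intervalIntegral.intervalIntegrable_rpow' (by linarith)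
  rw [← integral_rpow_sub_one hs, ← integral_rpow_sub_one (by linarith : 0 < s + 1),
    ← intervalIntegral.integral_sub h₁ h₂]
  refine intervalIntegral.integral_mono_on_of_le_Ioo hx (h₁.sub h₂)
    (intervalIntegrable_lowerGamma_integrand hs 0 x) fun t ht => ?_
  have hpow : t ^ (s + 1 - 1) = t ^ (s - 1) * t := by
    rw [← rpow_add_one ht.1.ne']
    ring_nf
  rw [hpow]
  nlinarith [rpow_nonneg ht.1.le (s - 1), Real.add_one_le_exp (-t)]

theorem abs_lowerGamma_sub_le {s x : ℝ} (hs : 0 < s) (hx : 0 ≤ x) :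
    |lowerGamma s x - x ^ s / s| ≤ x ^ (s + 1) / (s + 1) := by
  have hpos : 0 ≤ x ^ (s + 1) / (s + 1) := by positivity
  rw [abs_le]
  constructor <;> linarith [lowerGamma_le hs hx, sub_le_lowerGamma hs hx]

/-- The substitution `x = ζ t / γ` in the power `x ^ p`. -/
theorem mul_div_rpow {ζ t γ : ℝ} (hζ : 0 < ζ) (ht : 0 < t) (hγ : 0 < γ) (p : ℝ) :
    (ζ * t / γ) ^ p = ζ ^ p * γ ^ (-p) * t ^ p := by
  rw [div_rpow (by positivity) hγ.le, mul_rpow hζ.le ht.le, rpow_neg hγ.le]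
  ring

theorem abs_scaled_lowerGamma_sub_le {β ζ t γ : ℝ} (hβ : 0 < β) (hζ : 0 < ζ) (ht : 0 < t)
    (hγ : 0 < γ) :
    |ζ ^ (-β) * lowerGamma β (ζ * t / γ) - γ ^ (-β) * β⁻¹ * t ^ β|
      ≤ ζ * γ ^ (-β - 1) * (β + 1)⁻¹ * t ^ (β + 1) := by
  have hcancel : ζ ^ (-β) * ζ ^ β = 1 := by
    rw [← rpow_add hζ, neg_add_cancel, rpow_zero]
  have hsplit : ζ ^ (-β) * lowerGamma β (ζ * t / γ) - γ ^ (-β) * β⁻¹ * t ^ β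
      = ζ ^ (-β) * (lowerGamma β (ζ * t / γ) - (ζ * t / γ) ^ β / β) := by
    rw [mul_div_rpow hζ ht hγ]
    linear_combination (γ ^ (-β) * t ^ β * β⁻¹) * hcancel
  have hbound : ζ * γ ^ (-β - 1) * (β + 1)⁻¹ * t ^ (β + 1)
      = ζ ^ (-β) * ((ζ * t / γ) ^ (β + 1) / (β + 1)) := by
    rw [mul_div_rpow hζ ht hγ, rpow_add_one hζ.ne', neg_add, ← sub_eq_add_neg]
    linear_combination (-(ζ * γ ^ (-β - 1) * t ^ (β + 1) * (β + 1)⁻¹)) * hcancel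
  rw [hsplit, hbound, abs_mul, abs_of_pos (rpow_pos_of_pos hζ _)]
  exact mul_le_mul_of_nonneg_left (abs_lowerGamma_sub_le hβ (by positivity))
    (rpow_nonneg hζ.le _)

theorem integrableOn_lowerGamma_mul {β ζ γ : ℝ} (hβ : 0 < β) (hζ : 0 < ζ) (hγ : 0 < γ)
    {m : ℝ → ℝ} (hm : Measurable m)
    (hmom : IntegrableOn (fun t => t ^ β * m t) (Set.Ioi 0)) :
    IntegrableOn (fun t => lowerGamma β (ζ * t / γ) * m t) (Set.Ioi 0) := by
  have hmeas : Measurable fun t => lowerGamma β (ζ * t / γ) * m t :=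
    ((continuous_lowerGamma hβ).measurable.comp (by fun_prop)).mul hm
  refine (hmom.norm.const_mul (ζ ^ β * γ ^ (-β) / β)).mono' hmeas.aestronglyMeasurable ?_
  refine (ae_restrict_iff' measurableSet_Ioi).2 (.of_forall fun t (ht : 0 < t) => ?_)
  have hx : 0 ≤ ζ * t / γ := by positivity
  have hle := lowerGamma_le hβ hx
  rw [mul_div_rpow hζ ht hγ] at hle
  rw [norm_mul, norm_mul, Real.norm_of_nonneg (lowerGamma_nonneg β hx),
    Real.norm_of_nonneg (rpow_nonneg ht.le β)]
  calc lowerGamma β (ζ * t / γ) * ‖m t‖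
      ≤ ζ ^ β * γ ^ (-β) * t ^ β / β * ‖m t‖ := by gcongr
    _ = ζ ^ β * γ ^ (-β) / β * (t ^ β * ‖m t‖) := by ring

/-- For `β, ζ > 0` and a measurable nonnegative `m` with finite moments of
orders `β` and `β+1`, for every `γ̄ > 0`:
`|ζ^{−β} ∫_0^∞ Υ(β, ζt/γ̄) m(t) dt − γ̄^{−β} β^{−1} ∫_0^∞ t^β m(t) dt|
  ≤ ζ γ̄^{−β−1} (β+1)^{−1} ∫_0^∞ t^{β+1} m(t) dt`. -/
theorem lowerGamma_integral_first_order_approx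
    (β ζ : ℝ) (hβ : 0 < β) (hζ : 0 < ζ)
    (m : ℝ → ℝ) (hm_meas : Measurable m) (hm_nonneg : ∀ t > (0 : ℝ), 0 ≤ m t)
    (hmom₁ : MeasureTheory.IntegrableOn (fun t => t ^ β * m t) (Set.Ioi 0))
    (hmom₂ : MeasureTheory.IntegrableOn (fun t => t ^ (β + 1) * m t) (Set.Ioi 0)) :
    ∀ γ > (0 : ℝ),
      |ζ ^ (-β) * (∫ t in Set.Ioi 0, lowerGamma β (ζ * t / γ) * m t)
          - γ ^ (-β) * β⁻¹ * ∫ t in Set.Ioi 0, t ^ β * m t|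
        ≤ ζ * γ ^ (-β - 1) * (β + 1)⁻¹ * ∫ t in Set.Ioi 0, t ^ (β + 1) * m t := by
  intro γ hγ
  have hint := (integrableOn_lowerGamma_mul hβ hζ hγ hm_meas hmom₁).const_mul (ζ ^ (-β))
  rw [← integral_const_mul, ← integral_const_mul, ← integral_const_mul,
    ← integral_sub hint (hmom₁.const_mul _), ← Real.norm_eq_abs]
  refine norm_integral_le_of_norm_le (hmom₂.const_mul _) ?_
  refine (ae_restrict_iff' measurableSet_Ioi).2 (.of_forall fun t (ht : 0 < t) => ?_)
  rw [← mul_assoc, ← mul_assoc, ← mul_assoc, ← sub_mul, norm_mul,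
    Real.norm_of_nonneg (hm_nonneg t ht)]
  exact mul_le_mul_of_nonneg_right (abs_scaled_lowerGamma_sub_le hβ hζ ht hγ) (hm_nonneg t ht)
end

section
/- (Nakagami-m fading.) Let m₀ > 0 and f(a) = (m₀^{m₀}/Γ(m₀)) a^{m₀−1} e^{−m₀ a} for a > 0, and let m be an MMSE-type function with induced quantities I, I_∞, M̂. Then Ī(γ̄) = ∫_0^∞ f(a) I(γ̄ a) da satisfies, as γ̄ → ∞, Ī(γ̄) = I_∞ − (m₀^{m₀−1}/Γ(m₀)) M̂(m₀) · γ̄^{−m₀} + O(γ̄^{−m₀−1}); that is, the diversity order is m₀ and the coding gain is ((m₀^{m₀−1}/Γ(m₀)) M̂(m₀))^{−1/m₀}. -/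
open MeasureTheory Real Filter Set

theorem integrableOn_rpow_mul_of_exp_decay {m : ℝ → ℝ} (hm_cont : ContinuousOn m (Ioi 0))
    (hm_pos : ∀ t > 0, 0 < m t) (hm_lim : Tendsto m (nhdsWithin 0 (Ioi 0)) (nhds 1))
    (hm_decay : ∃ C > 0, ∃ c > 0, ∀ t ≥ 1, m t ≤ C * t ^ (-(1 : ℝ) / 2) * exp (-c * t))
    {p : ℝ} (hp : -1 < p) : IntegrableOn (fun t ↦ t ^ p * m t) (Ioi 0) := by
  obtain ⟨C, hC, c, hc, hdecay⟩ := hm_decay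
  have h_top : m =O[atTop] (fun t : ℝ ↦ t ^ (-(p + 2))) := by
    have h1 : m =O[atTop] (fun t : ℝ ↦ exp (-c * t)) := by
      refine Asymptotics.IsBigO.of_bound C ?_
      filter_upwards [eventually_ge_atTop 1] with t ht
      have ht0 : 0 < t := by linarith
      rw [norm_of_nonneg (hm_pos t ht0).le, norm_of_nonneg (exp_pos _).le]
      refine (hdecay t ht).trans ?_
      have : t ^ (-(1 : ℝ) / 2) ≤ 1 := rpow_le_one_of_one_le_of_nonpos ht (by norm_num)
      gcongr
      nlinarith
    exact h1.trans (isLittleO_exp_neg_mul_rpow_atTop hc _).isBigO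
  have h_bot : m =O[nhdsWithin 0 (Ioi 0)] (fun t : ℝ ↦ t ^ (-(0 : ℝ))) := by
    simpa using hm_lim.isBigO_one ℝ
  have := mellin_convergent_of_isBigO_scalar (s := p + 1)
    (hm_cont.locallyIntegrableOn measurableSet_Ioi) h_top (by linarith) h_bot (by linarith)
  simpa using this

theorem integrableOn_and_integral_rpow_mul_tail {m : ℝ → ℝ} (hm_nonneg : ∀ t > 0, 0 ≤ m t)
    (hm_int : IntegrableOn m (Ioi 0)) {p : ℝ} (hp : 0 < p)
    (hm_moment : IntegrableOn (fun t ↦ t ^ p * m t) (Ioi 0)) :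
    IntegrableOn (fun s ↦ s ^ (p - 1) * ∫ t in Ioi s, m t) (Ioi 0) ∧
      ∫ t in Ioi 0, t ^ p * m t = p * ∫ s in Ioi 0, s ^ (p - 1) * ∫ t in Ioi s, m t := by
  have h_ae : AEMeasurable (fun t ↦ ENNReal.ofReal (m t)) (volume.restrict (Ioi 0)) :=
    hm_int.aemeasurable.ennreal_ofReal
  set μ := (volume.restrict (Ioi (0 : ℝ))).withDensity (fun t ↦ ENNReal.ofReal (m t)) with hμ
  have h_nn : ∀ᵐ t ∂μ, (0 : ℝ) ≤ t :=
    (withDensity_absolutelyContinuous _ _).ae_le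
      ((ae_restrict_mem measurableSet_Ioi).mono fun t (ht : 0 < t) ↦ ht.le)
  have key := lintegral_rpow_eq_lintegral_meas_lt_mul μ (f := fun t : ℝ ↦ t) h_nn
    aemeasurable_id hp
  have h_left : ∫⁻ t, ENNReal.ofReal (t ^ p) ∂μ
      = ENNReal.ofReal (∫ t in Ioi 0, t ^ p * m t) := by
    rw [hμ, lintegral_withDensity_eq_lintegral_mul₀ h_ae (by fun_prop),
      ofReal_integral_eq_lintegral_ofReal hm_moment]
    · refine setLIntegral_congr_fun measurableSet_Ioi fun t (ht : 0 < t) ↦ ?_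
      simp only [Pi.mul_apply]
      rw [mul_comm, ENNReal.ofReal_mul (by positivity)]
    · filter_upwards [ae_restrict_mem measurableSet_Ioi] with t ht
      exact mul_nonneg (rpow_nonneg (le_of_lt ht) _) (hm_nonneg t ht)
  have h_tail_nonneg : ∀ s > 0, 0 ≤ ∫ t in Ioi s, m t := fun s hs ↦
    setIntegral_nonneg measurableSet_Ioi fun t ht ↦ hm_nonneg t (lt_trans hs ht)
  have h_meas : ∀ s > 0, μ {a | s < a} = ENNReal.ofReal (∫ t in Ioi s, m t) := by
    intro s hs
    have h_sub : Ioi s ⊆ Ioi (0 : ℝ) := Ioi_subset_Ioi hs.le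
    change μ (Ioi s) = _
    rw [hμ, withDensity_apply _ measurableSet_Ioi, Measure.restrict_restrict measurableSet_Ioi,
      inter_eq_left.mpr h_sub, ofReal_integral_eq_lintegral_ofReal (hm_int.mono_set h_sub)]
    filter_upwards [ae_restrict_mem measurableSet_Ioi] with t ht
    exact hm_nonneg t (h_sub ht)
  have h_right : ∫⁻ s in Ioi 0, μ {a | s < a} * ENNReal.ofReal (s ^ (p - 1))
      = ∫⁻ s in Ioi 0, ENNReal.ofReal (s ^ (p - 1) * ∫ t in Ioi s, m t) := by
    refine setLIntegral_congr_fun measurableSet_Ioi fun s (hs : 0 < s) ↦ ?_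
    rw [h_meas s hs, mul_comm, ENNReal.ofReal_mul (by positivity)]
  have h_anti : AntitoneOn (fun s ↦ ∫ t in Ioi s, m t) (Ioi 0) := by
    intro a ha b hb hab
    refine setIntegral_mono_set (hm_int.mono_set (Ioi_subset_Ioi (le_of_lt ha))) ?_
      (Ioi_subset_Ioi hab).eventuallyLE
    filter_upwards [ae_restrict_mem measurableSet_Ioi] with t ht
    exact hm_nonneg t (lt_trans ha ht)
  have h_aesm : AEStronglyMeasurable (fun s ↦ s ^ (p - 1) * ∫ t in Ioi s, m t)
      (volume.restrict (Ioi 0)) :=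
    ((by fun_prop : Measurable fun s : ℝ ↦ s ^ (p - 1)).aemeasurable.mul
      (aemeasurable_restrict_of_antitoneOn measurableSet_Ioi h_anti)).aestronglyMeasurable
  have h_prod_nonneg : 0 ≤ᵐ[volume.restrict (Ioi 0)] fun s ↦ s ^ (p - 1) * ∫ t in Ioi s, m t := by
    filter_upwards [ae_restrict_mem measurableSet_Ioi] with s hs
    exact mul_nonneg (rpow_nonneg (le_of_lt hs) _) (h_tail_nonneg s hs)
  rw [h_left, h_right] at key
  have h_int : IntegrableOn (fun s ↦ s ^ (p - 1) * ∫ t in Ioi s, m t) (Ioi 0) := by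
    refine (lintegral_ofReal_ne_top_iff_integrable h_aesm h_prod_nonneg).mp fun h ↦ ?_
    rw [h, ENNReal.mul_top (by simpa using hp)] at key
    exact ENNReal.ofReal_ne_top key
  refine ⟨h_int, ?_⟩
  rw [← ofReal_integral_eq_lintegral_ofReal h_int h_prod_nonneg,
    ← ENNReal.ofReal_mul hp.le] at key
  refine (ENNReal.ofReal_eq_ofReal_iff ?_ ?_).mp key
  · exact setIntegral_nonneg measurableSet_Ioi fun t ht ↦
      mul_nonneg (rpow_nonneg (le_of_lt ht) _) (hm_nonneg t ht)
  · exact mul_nonneg hp.le (integral_nonneg_of_ae h_prod_nonneg)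

theorem integrableOn_and_integral_rpow_mul_comp_mul_left {J : ℝ → ℝ} {q γ : ℝ} (hγ : 0 < γ)
    (hJ : IntegrableOn (fun s ↦ s ^ q * J s) (Ioi 0)) :
    IntegrableOn (fun a ↦ a ^ q * J (γ * a)) (Ioi 0) ∧
      ∫ a in Ioi 0, a ^ q * J (γ * a) = γ ^ (-q - 1) * ∫ s in Ioi 0, s ^ q * J s := by
  have h_eq : EqOn (fun a ↦ γ ^ (-q) * ((γ * a) ^ q * J (γ * a)))
      (fun a ↦ a ^ q * J (γ * a)) (Ioi 0) := by
    intro a (ha : 0 < a)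
    simp only []
    rw [mul_rpow hγ.le ha.le, rpow_neg hγ.le]
    field_simp
  constructor
  · refine IntegrableOn.congr_fun ?_ h_eq measurableSet_Ioi
    refine Integrable.const_mul ?_ _
    exact (integrableOn_Ioi_comp_mul_left_iff (fun s ↦ s ^ q * J s) 0 hγ).mpr (by simpa using hJ)
  · rw [← setIntegral_congr_fun measurableSet_Ioi h_eq, integral_const_mul,
      integral_comp_mul_left_Ioi (fun s ↦ s ^ q * J s) 0 hγ, rpow_sub_one hγ.ne']
    simp only [mul_zero, smul_eq_mul]
    ring

/-- **Nakagami-m fading.** For the Nakagami-`m₀` density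
`f(a) = (m₀^{m₀}/Γ(m₀)) a^{m₀−1} e^{−m₀ a}` and an MMSE-type function `m`, the AMI satisfies
`Ī(γ̄) = I_∞ − (m₀^{m₀−1}/Γ(m₀)) M̂(m₀) γ̄^{−m₀} + O(γ̄^{−m₀−1})` as `γ̄ → ∞`. -/
theorem asymptotic_AMI_nakagami
    (m₀ : ℝ) (hm₀ : 0 < m₀)
    (f : ℝ → ℝ)
    (hf : ∀ a > 0, f a = (m₀ ^ m₀ / Real.Gamma m₀) * a ^ (m₀ - 1) * Real.exp (-m₀ * a))
    (m : ℝ → ℝ)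
    (hm_cont : ContinuousOn m (Set.Ioi 0))
    (hm_pos : ∀ t > 0, 0 < m t)
    (hm_lim : Tendsto m (nhdsWithin 0 (Set.Ioi 0)) (nhds 1))
    (hm_decay : ∃ C > 0, ∃ c > 0, ∀ t ≥ 1, m t ≤ C * t ^ (-(1 : ℝ) / 2) * Real.exp (-c * t))
    (I : ℝ → ℝ) (hI : ∀ γ ≥ 0, I γ = ∫ t in Set.Ioc 0 γ, m t)
    (Iinf : ℝ) (hIinf : Iinf = ∫ t in Set.Ioi 0, m t)
    (Mhat : ℝ → ℝ) (hMhat : ∀ x > 0, Mhat x = ∫ t in Set.Ioi 0, t ^ x * m t)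
    (Ibar : ℝ → ℝ) (hIbar : ∀ γ > 0, Ibar γ = ∫ a in Set.Ioi 0, f a * I (γ * a)) :
    ∃ C' > 0, ∃ γ0 > 0, ∀ γ ≥ γ0,
      |Ibar γ - Iinf + (m₀ ^ (m₀ - 1) / Real.Gamma m₀) * Mhat m₀ * γ ^ (-m₀)|
        ≤ C' * γ ^ (-m₀ - 1) := by
  set J : ℝ → ℝ := fun s ↦ ∫ t in Ioi s, m t with hJ
  set K : ℝ := m₀ ^ m₀ / Real.Gamma m₀ with hK
  have hK_pos : 0 < K := div_pos (rpow_pos_of_pos hm₀ _) (Gamma_pos_of_pos hm₀)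
  have h_moment : ∀ p : ℝ, -1 < p → IntegrableOn (fun t ↦ t ^ p * m t) (Ioi 0) := fun p hp ↦
    integrableOn_rpow_mul_of_exp_decay hm_cont hm_pos hm_lim hm_decay hp
  have hm_nonneg : ∀ t > 0, 0 ≤ m t := fun t ht ↦ (hm_pos t ht).le
  have hm_int : IntegrableOn m (Ioi 0) := by simpa using h_moment 0 (by norm_num)
  obtain ⟨hJ_int₀, hJ_eq₀⟩ := integrableOn_and_integral_rpow_mul_tail hm_nonneg hm_int hm₀
    (h_moment m₀ (by linarith))
  obtain ⟨hJ_int₁, -⟩ := integrableOn_and_integral_rpow_mul_tail hm_nonneg hm_int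
    (p := m₀ + 1) (by linarith) (h_moment (m₀ + 1) (by linarith))
  rw [add_sub_cancel_right] at hJ_int₁
  rw [← hMhat m₀ hm₀] at hJ_eq₀
  have hJ_nonneg : ∀ s > 0, 0 ≤ J s := fun s hs ↦
    setIntegral_nonneg measurableSet_Ioi fun t ht ↦ hm_nonneg t (lt_trans hs ht)
  have hI_tail : ∀ s > 0, I s = Iinf - J s := by
    intro s hs
    rw [hI s hs.le, hIinf, ← Ioc_union_Ioi_eq_Ioi hs.le, setIntegral_union
      (Ioc_disjoint_Ioi le_rfl) measurableSet_Ioi (hm_int.mono_set Ioc_subset_Ioi_self)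
      (hm_int.mono_set (Ioi_subset_Ioi hs.le))]
    simp [hJ]
  have hf_eq : EqOn (fun a ↦ K * (a ^ (m₀ - 1) * exp (-(m₀ * a)))) f (Ioi 0) := by
    intro a ha
    rw [hf a ha, neg_mul, mul_assoc]
  have hgamma := integral_rpow_mul_exp_neg_mul_Ioi hm₀ hm₀
  have hf_int : IntegrableOn f (Ioi 0) := by
    refine IntegrableOn.congr_fun (Integrable.const_mul ?_ K) hf_eq measurableSet_Ioi
    refine .of_integral_ne_zero ?_
    rw [hgamma]
    exact (mul_pos (by positivity) (Gamma_pos_of_pos hm₀)).ne'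
  have hf_one : ∫ a in Ioi 0, f a = 1 := by
    rw [← setIntegral_congr_fun measurableSet_Ioi hf_eq, integral_const_mul, hgamma, hK,
      one_div, inv_rpow hm₀.le]
    have := (Gamma_pos_of_pos hm₀).ne'
    have := (rpow_pos_of_pos hm₀ m₀).ne'
    field_simp
  set D : ℝ := ∫ s in Ioi 0, s ^ m₀ * J s with hD
  have hD_nonneg : 0 ≤ D := setIntegral_nonneg measurableSet_Ioi fun s (hs : 0 < s) ↦
    mul_nonneg (by positivity) (hJ_nonneg s hs)
  refine ⟨K * m₀ * D + 1, by positivity, 1, one_pos, fun γ hγ ↦ ?_⟩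
  have hγ0 : 0 < γ := by linarith
  obtain ⟨hS_int₀, hS_eq₀⟩ := integrableOn_and_integral_rpow_mul_comp_mul_left hγ0 hJ_int₀
  obtain ⟨hS_int₁, hS_eq₁⟩ := integrableOn_and_integral_rpow_mul_comp_mul_left hγ0 hJ_int₁
  have h_lower : ∀ a > 0, 0 ≤ K * (a ^ (m₀ - 1) * J (γ * a)) - f a * J (γ * a) := by
    intro a ha
    have h1 := hJ_nonneg (γ * a) (by positivity)
    have h2 : exp (-(m₀ * a)) ≤ 1 := exp_le_one_iff.mpr (by nlinarith)
    rw [← hf_eq ha]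
    have : 0 ≤ K * (a ^ (m₀ - 1) * J (γ * a)) * (1 - exp (-(m₀ * a))) :=
      mul_nonneg (by positivity) (by linarith)
    simp only []
    linarith
  have h_upper : ∀ a > 0, K * (a ^ (m₀ - 1) * J (γ * a)) - f a * J (γ * a)
      ≤ K * m₀ * (a ^ m₀ * J (γ * a)) := by
    intro a ha
    have h1 := hJ_nonneg (γ * a) (by positivity)
    have h2 := add_one_le_exp (-(m₀ * a))
    have h3 : a ^ m₀ = a ^ (m₀ - 1) * a := by
      rw [rpow_sub_one ha.ne']
      field_simp
    rw [← hf_eq ha, h3]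
    have : K * (a ^ (m₀ - 1) * J (γ * a)) * (1 - exp (-(m₀ * a)))
        ≤ K * (a ^ (m₀ - 1) * J (γ * a)) * (m₀ * a) :=
      mul_le_mul_of_nonneg_left (by linarith) (by positivity)
    simp only []
    linarith
  have hfJ_int : IntegrableOn (fun a ↦ f a * J (γ * a)) (Ioi 0) := by
    have h_exp : IntegrableOn (fun a ↦ exp (-(m₀ * a)) * (K * (a ^ (m₀ - 1) * J (γ * a))))
        (Ioi 0) := by
      refine (hS_int₀.const_mul K).bdd_mul (c := 1) (by fun_prop) ?_
      filter_upwards [ae_restrict_mem measurableSet_Ioi] with a (ha : 0 < a)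
      rw [norm_of_nonneg (exp_pos _).le]
      exact exp_le_one_iff.mpr (by nlinarith)
    refine h_exp.congr_fun (fun a ha ↦ ?_) measurableSet_Ioi
    simp only [← hf_eq ha]
    ring
  have hIbar_eq : Ibar γ = Iinf - ∫ a in Ioi 0, f a * J (γ * a) := by
    have h_congr : EqOn (fun a ↦ f a * I (γ * a)) (fun a ↦ f a * Iinf - f a * J (γ * a))
        (Ioi 0) := by
      intro a (ha : 0 < a)
      simp only []
      rw [hI_tail (γ * a) (by positivity)]
      ring
    rw [hIbar γ hγ0, setIntegral_congr_fun measurableSet_Ioi h_congr,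
      integral_sub (hf_int.mul_const _) hfJ_int, integral_mul_const, hf_one, one_mul]
  have h_main : (m₀ ^ (m₀ - 1) / Real.Gamma m₀) * Mhat m₀ * γ ^ (-m₀)
      = ∫ a in Ioi 0, K * (a ^ (m₀ - 1) * J (γ * a)) := by
    rw [integral_const_mul, hS_eq₀, hJ_eq₀, rpow_sub_one hm₀.ne',
      show -(m₀ - 1) - 1 = -m₀ by ring, hK]
    field_simp
  have h_diff : Ibar γ - Iinf + (m₀ ^ (m₀ - 1) / Real.Gamma m₀) * Mhat m₀ * γ ^ (-m₀)
      = ∫ a in Ioi 0, (K * (a ^ (m₀ - 1) * J (γ * a)) - f a * J (γ * a)) := by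
    rw [integral_sub (hS_int₀.const_mul K) hfJ_int, ← h_main, hIbar_eq]
    ring
  rw [h_diff, abs_of_nonneg (setIntegral_nonneg measurableSet_Ioi h_lower)]
  calc ∫ a in Ioi 0, (K * (a ^ (m₀ - 1) * J (γ * a)) - f a * J (γ * a))
      ≤ ∫ a in Ioi 0, K * m₀ * (a ^ m₀ * J (γ * a)) :=
        setIntegral_mono_on ((hS_int₀.const_mul K).sub hfJ_int) (hS_int₁.const_mul _)
          measurableSet_Ioi h_upper
    _ = K * m₀ * D * γ ^ (-m₀ - 1) := by
        rw [integral_const_mul, hS_eq₁]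
        ring
    _ ≤ (K * m₀ * D + 1) * γ ^ (-m₀ - 1) := by
        gcongr
        linarith
end

section
/- (κ-μ fading.) Let μ > 0 and κ > 0. For l ≥ 1 set α_l = μ^{μ+2l−2} κ^{l−1} (1+κ)^{μ+l−1} / (e^{μκ} Γ(μ+l−1) Γ(l)), and define f(a) = Σ_{l=1}^∞ α_l a^{μ+l−2} e^{−μ(1+κ) a} for a > 0. Let m be an MMSE-type function with induced quantities I, I_∞, M̂. Then f is a probability density on (0,∞), and Ī(γ̄) = ∫_0^∞ f(a) I(γ̄ a) da satisfies, as γ̄ → ∞, Ī(γ̄) = I_∞ − (α_1/μ) M̂(μ) · γ̄^{−μ} + O(γ̄^{−μ−1}), where α_1 = μ^μ (1+κ)^μ / (e^{μκ} Γ(μ)); that is, the diversity order is μ and the coding gain is ((α_1/μ) M̂(μ))^{−1/μ}. -/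
open MeasureTheory Real Filter Set

theorem integrableOn_rpow_mul_of_exp_decay_s9 {m : ℝ → ℝ} {b : ℝ} (hcont : ContinuousOn m (Ioi 0))
    (hpos : ∀ t > 0, 0 < m t) (hlim : Tendsto m (nhdsWithin 0 (Ioi 0)) (nhds b))
    (hdecay : ∃ C > 0, ∃ c > 0, ∀ t ≥ 1, m t ≤ C * t ^ (-(1 : ℝ) / 2) * Real.exp (-c * t))
    {s : ℝ} (hs : 0 ≤ s) : IntegrableOn (fun t => t ^ s * m t) (Ioi 0) := by
  have hcont' : ContinuousOn (fun t => t ^ s * m t) (Ioi 0) :=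
    (Real.continuous_rpow_const hs).continuousOn.mul hcont
  refine integrableOn_Ioi_iff_integrableAtFilter_atTop_nhdsWithin.2 ⟨?_, ?_, ?_⟩
  · obtain ⟨C, hC, c, hc, h⟩ := hdecay
    refine ⟨Ioi 1, Ioi_mem_atTop 1, integrable_of_isBigO_exp_neg (half_pos hc)
      (hcont'.mono (Ici_subset_Ioi.2 one_pos)) ?_⟩
    have h1 : m =O[atTop] fun t => Real.exp (-c * t) := by
      refine Asymptotics.IsBigO.of_bound C ?_
      filter_upwards [eventually_ge_atTop 1] with t ht
      rw [Real.norm_of_nonneg (hpos t (by linarith)).le, Real.norm_of_nonneg (Real.exp_pos _).le]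
      refine (h t ht).trans ?_
      have : t ^ (-(1 : ℝ) / 2) ≤ 1 := Real.rpow_le_one_of_one_le_of_nonpos ht (by norm_num)
      gcongr
      nlinarith
    refine ((isLittleO_rpow_exp_pos_mul_atTop s (half_pos hc)).isBigO.mul h1).congr_right ?_
    intro t
    rw [← Real.exp_add]
    ring_nf
  · refine Tendsto.integrableAtFilter (b := (0 : ℝ) ^ s * b)
      ⟨Ioi 0, self_mem_nhdsWithin, hcont'.aestronglyMeasurable measurableSet_Ioi⟩
      (Measure.finiteAt_nhdsWithin _ _ _) ?_
    exact ((Real.continuous_rpow_const hs).tendsto 0 |>.mono_left nhdsWithin_le_nhds).mul hlim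
  · exact hcont'.locallyIntegrableOn measurableSet_Ioi

theorem integral_rpow_mul_measureReal_Ioi {ν : Measure ℝ} [IsFiniteMeasure ν]
    (hν : ∀ᵐ t ∂ν, 0 ≤ t) {s : ℝ} (hs : 0 < s) (hint : Integrable (fun t => t ^ s) ν) :
    IntegrableOn (fun a => a ^ (s - 1) * ν.real (Ioi a)) (Ioi 0) ∧
      ∫ a in Ioi 0, a ^ (s - 1) * ν.real (Ioi a) = (∫ t, t ^ s ∂ν) / s := by
  have hnn : 0 ≤ᵐ[ν] fun t => t ^ s := by
    filter_upwards [hν] with t ht using Real.rpow_nonneg ht s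
  have key := lintegral_rpow_eq_lintegral_meas_lt_mul ν (f := id) hν aemeasurable_id hs
  simp only [id] at key
  rw [← ofReal_integral_eq_lintegral_ofReal hint hnn] at key
  have hmeas : Measurable fun a : ℝ => ν (Ioi a) :=
    Antitone.measurable fun a b hab => measure_mono (Ioi_subset_Ioi hab)
  have hmeas' : AEMeasurable (fun t : ℝ => ν {a | t < a} * ENNReal.ofReal (t ^ (s - 1)))
      (volume.restrict (Ioi 0)) :=
    (hmeas.mul (measurable_id.pow_const _).ennreal_ofReal).aemeasurable
  have hfin : ∫⁻ t in Ioi 0, ν {a | t < a} * ENNReal.ofReal (t ^ (s - 1)) ≠ ⊤ := by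
    intro h
    rw [h, ENNReal.mul_top (by simpa using hs)] at key
    exact ENNReal.ofReal_ne_top key
  have heq : EqOn (fun t => (ν {a | t < a} * ENNReal.ofReal (t ^ (s - 1))).toReal)
      (fun a => a ^ (s - 1) * ν.real (Ioi a)) (Ioi 0) := by
    intro t ht
    simp only [ENNReal.toReal_mul, ENNReal.toReal_ofReal (Real.rpow_nonneg (le_of_lt ht) (s - 1))]
    exact mul_comm _ _
  refine ⟨IntegrableOn.congr_fun (integrable_toReal_of_lintegral_ne_top hmeas' hfin) heq
    measurableSet_Ioi, ?_⟩
  rw [← setIntegral_congr_fun measurableSet_Ioi heq,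
    integral_toReal hmeas' (ae_lt_top' hmeas' hfin), eq_div_iff hs.ne']
  have := congrArg ENNReal.toReal key
  rw [ENNReal.toReal_mul, ENNReal.toReal_ofReal hs.le,
    ENNReal.toReal_ofReal (integral_nonneg_of_ae hnn)] at this
  rw [this, mul_comm]

theorem integral_rpow_mul_integral_Ioi {m : ℝ → ℝ} (hm : IntegrableOn m (Ioi 0))
    (hnn : ∀ t > 0, 0 ≤ m t) {s : ℝ} (hs : 0 < s)
    (hint : IntegrableOn (fun t => t ^ s * m t) (Ioi 0)) :
    IntegrableOn (fun a => a ^ (s - 1) * ∫ t in Ioi a, m t) (Ioi 0) ∧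
      ∫ a in Ioi 0, a ^ (s - 1) * ∫ t in Ioi a, m t = (∫ t in Ioi 0, t ^ s * m t) / s := by
  set ν : Measure ℝ := (volume.restrict (Ioi 0)).withDensity fun t => ENNReal.ofReal (m t) with hνdef
  have : IsFiniteMeasure ν := isFiniteMeasure_withDensity_ofReal hm.2
  have hae : AEMeasurable (fun t => ENNReal.ofReal (m t)) (volume.restrict (Ioi 0)) :=
    hm.aemeasurable.ennreal_ofReal
  have hlt : ∀ᵐ t ∂(volume.restrict (Ioi (0 : ℝ))), ENNReal.ofReal (m t) < ⊤ :=
    Eventually.of_forall fun _ => ENNReal.ofReal_lt_top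
  have hν : ∀ᵐ t ∂ν, 0 ≤ t :=
    (withDensity_absolutelyContinuous _ _).ae_le
      ((ae_restrict_mem measurableSet_Ioi).mono fun t ht => le_of_lt ht)
  have hcongr : EqOn (fun t => (ENNReal.ofReal (m t)).toReal • t ^ s) (fun t => t ^ s * m t)
      (Ioi 0) := by
    intro t ht
    simp only [ENNReal.toReal_ofReal (hnn t ht), smul_eq_mul, mul_comm]
  have hintν : Integrable (fun t => t ^ s) ν :=
    (integrable_withDensity_iff_integrable_smul₀' hae hlt).2
      (hint.congr_fun hcongr.symm measurableSet_Ioi)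
  have htail : EqOn (fun a => a ^ (s - 1) * ν.real (Ioi a))
      (fun a => a ^ (s - 1) * ∫ t in Ioi a, m t) (Ioi 0) := by
    intro a ha
    have hsub : Ioi a ⊆ Ioi 0 := Ioi_subset_Ioi (le_of_lt ha)
    simp only [measureReal_def, hνdef, withDensity_apply _ (measurableSet_Ioi (a := a)),
      Measure.restrict_restrict (measurableSet_Ioi (a := a)), inter_eq_left.2 hsub]
    rw [← ofReal_integral_eq_lintegral_ofReal (hm.mono_set hsub)
      ((ae_restrict_mem measurableSet_Ioi).mono fun t ht => hnn t (hsub ht)),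
      ENNReal.toReal_ofReal (setIntegral_nonneg measurableSet_Ioi fun t ht => hnn t (hsub ht))]
  obtain ⟨h1, h2⟩ := integral_rpow_mul_measureReal_Ioi hν hs hintν
  refine ⟨h1.congr_fun htail measurableSet_Ioi, ?_⟩
  rw [← setIntegral_congr_fun measurableSet_Ioi htail, h2,
    integral_withDensity_eq_integral_toReal_smul₀ hae hlt,
    setIntegral_congr_fun measurableSet_Ioi hcongr]

theorem integral_rpow_mul_integral_Ioi_mul {m : ℝ → ℝ} (hm : IntegrableOn m (Ioi 0))
    (hnn : ∀ t > 0, 0 ≤ m t) {s : ℝ} (hs : 0 < s)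
    (hint : IntegrableOn (fun t => t ^ s * m t) (Ioi 0)) {γ : ℝ} (hγ : 0 < γ) :
    IntegrableOn (fun a => a ^ (s - 1) * ∫ t in Ioi (γ * a), m t) (Ioi 0) ∧
      ∫ a in Ioi 0, a ^ (s - 1) * ∫ t in Ioi (γ * a), m t =
        (∫ t in Ioi 0, t ^ s * m t) / s * γ ^ (-s) := by
  obtain ⟨h1, h2⟩ := integral_rpow_mul_integral_Ioi hm hnn hs hint
  have heq : EqOn (fun a => γ ^ (1 - s) * ((γ * a) ^ (s - 1) * ∫ t in Ioi (γ * a), m t))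
      (fun a => a ^ (s - 1) * ∫ t in Ioi (γ * a), m t) (Ioi 0) := by
    intro a ha
    have h : γ ^ (1 - s) * γ ^ (s - 1) = 1 := by rw [← Real.rpow_add hγ]; simp
    simp only [Real.mul_rpow hγ.le (le_of_lt ha)]
    linear_combination (a ^ (s - 1) * ∫ t in Ioi (γ * a), m t) * h
  constructor
  · refine IntegrableOn.congr_fun (Integrable.const_mul ?_ _) heq measurableSet_Ioi
    exact (integrableOn_Ioi_comp_mul_left_iff (fun a => a ^ (s - 1) * ∫ t in Ioi a, m t) 0 hγ).2
      (by simpa using h1)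
  · rw [← setIntegral_congr_fun measurableSet_Ioi heq, integral_const_mul,
      integral_comp_mul_left_Ioi (fun a => a ^ (s - 1) * ∫ t in Ioi a, m t) 0 hγ, mul_zero, h2,
      smul_eq_mul, ← Real.rpow_neg_one γ, ← mul_assoc, ← Real.rpow_add hγ, mul_comm]
    ring_nf

theorem abs_integral_mul_integral_Ioc_sub_le {m f : ℝ → ℝ} {A K s : ℝ}
    (hm : IntegrableOn m (Ioi 0)) (hnn : ∀ t > 0, 0 ≤ m t) (hs : 0 < s)
    (hint : IntegrableOn (fun t => t ^ s * m t) (Ioi 0))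
    (hint' : IntegrableOn (fun t => t ^ (s + 1) * m t) (Ioi 0))
    (hf : IntegrableOn f (Ioi 0)) (hf1 : ∫ a in Ioi 0, f a = 1)
    (hfA : ∀ a > 0, |f a - A * a ^ (s - 1)| ≤ K * a ^ s) {γ : ℝ} (hγ : 0 < γ) :
    |(∫ a in Ioi 0, f a * ∫ t in Ioc 0 (γ * a), m t) - (∫ t in Ioi 0, m t)
        + A / s * (∫ t in Ioi 0, t ^ s * m t) * γ ^ (-s)|
      ≤ K * ((∫ t in Ioi 0, t ^ (s + 1) * m t) / (s + 1)) * γ ^ (-s - 1) := by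
  obtain ⟨h1, h2⟩ := integral_rpow_mul_integral_Ioi_mul hm hnn hs hint hγ
  obtain ⟨h3, h4⟩ := integral_rpow_mul_integral_Ioi_mul hm hnn (by linarith : 0 < s + 1) hint' hγ
  simp only [add_sub_cancel_right] at h3 h4
  set R : ℝ → ℝ := fun a => ∫ t in Ioi (γ * a), m t with hR
  have hRnn : ∀ a > 0, 0 ≤ R a := fun a ha =>
    setIntegral_nonneg measurableSet_Ioi fun t ht => hnn t (lt_trans (mul_pos hγ ha) ht)
  have hbound : ∀ a > 0, ‖(f a - A * a ^ (s - 1)) * R a‖ ≤ K * (a ^ s * R a) := by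
    intro a ha
    rw [norm_mul, Real.norm_eq_abs, Real.norm_of_nonneg (hRnn a ha), ← mul_assoc]
    exact mul_le_mul_of_nonneg_right (hfA a ha) (hRnn a ha)
  have hRmeas : AEStronglyMeasurable R (volume.restrict (Ioi 0)) := by
    refine (aemeasurable_restrict_of_antitoneOn measurableSet_Ioi ?_).aestronglyMeasurable
    intro a ha b hb hab
    have hγa : 0 < γ * a := mul_pos hγ ha
    refine setIntegral_mono_set (hm.mono_set (Ioi_subset_Ioi hγa.le)) ?_
      (Ioi_subset_Ioi (mul_le_mul_of_nonneg_left hab hγ.le)).eventuallyLE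
    exact (ae_restrict_mem measurableSet_Ioi).mono fun t ht => hnn t (lt_trans hγa ht)
  have hpow : AEStronglyMeasurable (fun a : ℝ => A * a ^ (s - 1)) (volume.restrict (Ioi 0)) :=
    ((measurable_id.pow_const _).const_mul A).aestronglyMeasurable
  have hdiff : IntegrableOn (fun a => (f a - A * a ^ (s - 1)) * R a) (Ioi 0) :=
    Integrable.mono' (h3.const_mul K) ((hf.aestronglyMeasurable.sub hpow).mul hRmeas)
      ((ae_restrict_mem measurableSet_Ioi).mono hbound)
  have hmain : IntegrableOn (fun a => A * (a ^ (s - 1) * R a)) (Ioi 0) := h1.const_mul A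
  have hadd : IntegrableOn (fun a => A * (a ^ (s - 1) * R a) + (f a - A * a ^ (s - 1)) * R a)
      (Ioi 0) := hmain.add hdiff
  have hsplit : EqOn (fun a => f a * ∫ t in Ioc 0 (γ * a), m t)
      (fun a => f a * (∫ t in Ioi 0, m t) - (A * (a ^ (s - 1) * R a)
        + (f a - A * a ^ (s - 1)) * R a)) (Ioi 0) := by
    intro a ha
    have hγa : 0 < γ * a := mul_pos hγ ha
    have : ∫ t in Ioi 0, m t = (∫ t in Ioc 0 (γ * a), m t) + R a := by
      rw [← Ioc_union_Ioi_eq_Ioi hγa.le]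
      exact setIntegral_union (Ioc_disjoint_Ioi le_rfl) measurableSet_Ioi
        (hm.mono_set Ioc_subset_Ioi_self) (hm.mono_set (Ioi_subset_Ioi hγa.le))
    simp only [this]
    ring
  rw [setIntegral_congr_fun measurableSet_Ioi hsplit, integral_sub (hf.mul_const _)
    hadd, integral_add hmain hdiff, integral_mul_const, hf1, integral_const_mul, h2]
  have hfinal : |∫ a in Ioi 0, (f a - A * a ^ (s - 1)) * R a| ≤
      K * ((∫ t in Ioi 0, t ^ (s + 1) * m t) / (s + 1)) * γ ^ (-s - 1) := by
    refine (norm_integral_le_of_norm_le (h3.const_mul K)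
      ((ae_restrict_mem measurableSet_Ioi).mono hbound)).trans_eq ?_
    rw [integral_const_mul, h4, neg_add', mul_assoc]
  rw [← abs_neg] at hfinal
  convert hfinal using 2
  ring

theorem abs_exp_neg_mul_tsum_sub_le {d : ℕ → ℝ} {D x : ℝ} (hd0 : ∀ n, 0 ≤ d n)
    (hdD : ∀ n, d n ≤ D) (hx : 0 ≤ x) :
    |Real.exp (-x) * ∑' n, d n * (x ^ n / n.factorial) - d 0| ≤ D * x := by
  have hexp : HasSum (fun n : ℕ => x ^ n / n.factorial) (Real.exp x) := by
    rw [Real.exp_eq_exp_ℝ]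
    exact NormedSpace.expSeries_div_hasSum_exp x
  have hD : 0 ≤ D := (hd0 0).trans (hdD 0)
  have hs : Summable fun n => d n * (x ^ n / n.factorial) :=
    Summable.of_nonneg_of_le (fun n => mul_nonneg (hd0 n) (by positivity))
      (fun n => mul_le_mul_of_nonneg_right (hdD n) (by positivity)) (hexp.summable.mul_left D)
  have hsub : HasSum (fun n => (d n - d 0) * (x ^ n / n.factorial))
      ((∑' n, d n * (x ^ n / n.factorial)) - d 0 * Real.exp x) := by
    simpa only [sub_mul] using hs.hasSum.sub (hexp.mul_left (d 0))
  have hone : HasSum (fun n : ℕ => D * (x ^ n / n.factorial - if n = 0 then 1 else 0))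
      (D * (Real.exp x - 1)) :=
    (hexp.sub (hasSum_ite_eq 0 1)).mul_left D
  have hle : |(∑' n, d n * (x ^ n / n.factorial)) - d 0 * Real.exp x| ≤ D * (Real.exp x - 1) := by
    rw [← hsub.tsum_eq, ← Real.norm_eq_abs]
    refine tsum_of_norm_bounded hone fun n => ?_
    rcases eq_or_ne n 0 with rfl | hn
    · simp
    · rw [if_neg hn, sub_zero, norm_mul, Real.norm_eq_abs,
        Real.norm_of_nonneg (by positivity : 0 ≤ x ^ n / (n.factorial : ℝ))]
      refine mul_le_mul_of_nonneg_right (abs_le.2 ⟨?_, ?_⟩) (by positivity)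
      · linarith [hd0 n, hdD 0]
      · linarith [hd0 0, hdD n]
  have hcancel : Real.exp (-x) * Real.exp x = 1 := by rw [← Real.exp_add]; simp
  calc |Real.exp (-x) * ∑' n, d n * (x ^ n / n.factorial) - d 0|
      = Real.exp (-x) * |(∑' n, d n * (x ^ n / n.factorial)) - d 0 * Real.exp x| := by
        rw [← abs_of_pos (Real.exp_pos (-x)), ← abs_mul, abs_of_pos (Real.exp_pos (-x)), mul_sub]
        congr 2
        linear_combination (-d 0) * hcancel
    _ ≤ Real.exp (-x) * (D * (Real.exp x - 1)) :=
        mul_le_mul_of_nonneg_left hle (Real.exp_pos _).le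
    _ = D * (1 - Real.exp (-x)) := by linear_combination D * hcancel
    _ ≤ D * x := mul_le_mul_of_nonneg_left (by linarith [Real.add_one_le_exp (-x)]) hD

theorem exists_pow_div_Gamma_add_le {μ y : ℝ} (hμ : 0 < μ) (hy : 0 < y) :
    ∃ D, ∀ n : ℕ, y ^ n / Real.Gamma (μ + n) ≤ D := by
  have hpos : ∀ n : ℕ, 0 < y ^ n / Real.Gamma (μ + n) := fun n =>
    div_pos (pow_pos hy n) (Real.Gamma_pos_of_pos (by positivity))
  have hratio : ∀ n : ℕ, ‖y ^ (n + 1) / Real.Gamma (μ + (n + 1 : ℕ))‖ / ‖y ^ n / Real.Gamma (μ + n)‖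
      = y / (μ + n) := by
    intro n
    have hμn : 0 < μ + n := by positivity
    have := Real.Gamma_pos_of_pos hμn
    rw [Real.norm_of_nonneg (hpos _).le, Real.norm_of_nonneg (hpos _).le, Nat.cast_succ,
      ← add_assoc, Real.Gamma_add_one hμn.ne']
    field_simp
    ring
  have hsum : Summable fun n : ℕ => y ^ n / Real.Gamma (μ + n) := by
    refine summable_of_ratio_test_tendsto_lt_one zero_lt_one
      (Eventually.of_forall fun n => (hpos n).ne') ?_
    simp only [hratio]
    exact tendsto_const_nhds.div_atTop
      (tendsto_atTop_add_const_left _ _ tendsto_natCast_atTop_atTop)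
  exact ⟨_, fun n => hsum.le_tsum n fun k _ => (hpos k).le⟩

theorem integral_gamma_mixture {μ β y : ℝ} (hμ : 0 < μ) (hβ : 0 < β) (hy : 0 < y)
    {α : ℕ → ℝ} (hα : ∀ n : ℕ, α n = β ^ (μ + n) * Real.exp (-y) * (y ^ n / n.factorial) /
      Real.Gamma (μ + n)) :
    ∫ a in Ioi 0, ∑' n : ℕ, α n * a ^ (μ + (n : ℝ) - 1) * Real.exp (-β * a) = 1 := by
  have hpos : ∀ n : ℕ, 0 < Real.Gamma (μ + n) := fun n => Real.Gamma_pos_of_pos (by positivity)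
  have hαnn : ∀ n, 0 ≤ α n := fun n => by
    have := hpos n
    rw [hα]
    positivity
  have hgamma : ∀ n : ℕ, ∫ a in Ioi 0, a ^ (μ + (n : ℝ) - 1) * Real.exp (-(β * a)) =
      (1 / β) ^ (μ + (n : ℝ)) * Real.Gamma (μ + n) := fun n =>
    Real.integral_rpow_mul_exp_neg_mul_Ioi (by positivity) hβ
  have hterm : ∀ n : ℕ, ∫ a in Ioi 0, α n * a ^ (μ + (n : ℝ) - 1) * Real.exp (-β * a) =
      Real.exp (-y) * (y ^ n / n.factorial) := by
    intro n
    simp only [mul_assoc, neg_mul]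
    rw [integral_const_mul, hgamma, hα, Real.div_rpow zero_le_one hβ.le, Real.one_rpow]
    have := hpos n
    have := Real.rpow_pos_of_pos hβ (μ + n)
    field_simp
  have hint : ∀ n : ℕ, IntegrableOn
      (fun a => α n * a ^ (μ + (n : ℝ) - 1) * Real.exp (-β * a)) (Ioi 0) := by
    intro n
    refine Integrable.of_integral_ne_zero ?_
    rw [hterm]
    positivity
  have hexp : HasSum (fun n : ℕ => Real.exp (-y) * (y ^ n / n.factorial)) 1 := by
    have h := (NormedSpace.expSeries_div_hasSum_exp y).mul_left (Real.exp (-y))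
    rwa [← Real.exp_eq_exp_ℝ, ← Real.exp_add, neg_add_cancel, Real.exp_zero] at h
  have hnorm : ∀ n : ℕ, ∫ a in Ioi 0, ‖α n * a ^ (μ + (n : ℝ) - 1) * Real.exp (-β * a)‖ =
      Real.exp (-y) * (y ^ n / n.factorial) := by
    intro n
    rw [← hterm]
    refine setIntegral_congr_fun measurableSet_Ioi fun a ha => Real.norm_of_nonneg ?_
    exact mul_nonneg (mul_nonneg (hαnn n) (Real.rpow_nonneg (le_of_lt ha) _)) (Real.exp_pos _).le
  have h := hasSum_integral_of_summable_integral_norm hint (by simpa only [hnorm] using hexp.summable)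
  simp only [hterm] at h
  exact h.unique hexp

theorem exists_abs_gamma_mixture_sub_le {μ β y : ℝ} (hμ : 0 < μ) (hβ : 0 < β) (hy : 0 < y)
    {α : ℕ → ℝ} (hα : ∀ n : ℕ, α n = β ^ (μ + n) * Real.exp (-y) * (y ^ n / n.factorial) /
      Real.Gamma (μ + n)) :
    ∃ K, ∀ a > 0, |(∑' n : ℕ, α n * a ^ (μ + (n : ℝ) - 1) * Real.exp (-β * a))
      - α 0 * a ^ (μ - 1)| ≤ K * a ^ μ := by
  obtain ⟨D, hD⟩ := exists_pow_div_Gamma_add_le hμ hy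
  have hpos : ∀ n : ℕ, 0 < Real.Gamma (μ + n) := fun n => Real.Gamma_pos_of_pos (by positivity)
  refine ⟨β ^ μ * Real.exp (-y) * (D * β), fun a ha => ?_⟩
  set B := β ^ μ * Real.exp (-y) * a ^ (μ - 1) with hB
  have hBnn : 0 ≤ B := by positivity
  have hterm : ∀ n : ℕ, α n * a ^ (μ + (n : ℝ) - 1) * Real.exp (-β * a) =
      B * Real.exp (-(β * a)) * (y ^ n / Real.Gamma (μ + n) * ((β * a) ^ n / n.factorial)) := by
    intro n
    rw [hα, hB, Real.rpow_add hβ, add_sub_right_comm, Real.rpow_add ha, Real.rpow_natCast,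
      Real.rpow_natCast, mul_pow, neg_mul]
    ring
  have hzero : α 0 * a ^ (μ - 1) = B * (y ^ 0 / Real.Gamma (μ + (0 : ℕ))) := by
    rw [hα, hB]
    simp
    ring
  have hle := abs_exp_neg_mul_tsum_sub_le (d := fun n : ℕ => y ^ n / Real.Gamma (μ + n))
    (fun n => (div_pos (pow_pos hy n) (hpos n)).le) hD (mul_pos hβ ha).le
  simp only [hterm]
  rw [tsum_mul_left, hzero, mul_assoc B, ← mul_sub, abs_mul, abs_of_nonneg hBnn]
  refine (mul_le_mul_of_nonneg_left hle hBnn).trans_eq ?_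
  have : a ^ μ = a ^ (μ - 1) * a := by
    rw [← Real.rpow_add_one ha.ne']
    simp
  rw [this, hB]
  ring

/-- **κ-μ fading.** For the κ-μ density, written as an infinite gamma mixture
(indexing: the paper's `l ≥ 1` corresponds to `n = l - 1 : ℕ` below), the AMI satisfies
`Ī(γ̄) = I_∞ − (α₁/μ) M̂(μ) γ̄^{−μ} + O(γ̄^{−μ−1})` as `γ̄ → ∞`, where
`α₁ = μ^μ (1+κ)^μ / (e^{μκ} Γ(μ))`; moreover `f` is a probability density on `(0,∞)`. -/
theorem asymptotic_AMI_kappa_mu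
    (μ κ : ℝ) (hμ : 0 < μ) (hκ : 0 < κ)
    (α : ℕ → ℝ)
    (hα : ∀ n : ℕ, α n =
      μ ^ (μ + 2 * (n : ℝ)) * κ ^ n * (1 + κ) ^ (μ + (n : ℝ)) /
        (Real.exp (μ * κ) * Real.Gamma (μ + (n : ℝ)) * Real.Gamma ((n : ℝ) + 1)))
    (f : ℝ → ℝ)
    (hf : ∀ a > 0, f a =
      ∑' n : ℕ, α n * a ^ (μ + (n : ℝ) - 1) * Real.exp (-(μ * (1 + κ)) * a))
    (m : ℝ → ℝ)
    (hm_cont : ContinuousOn m (Set.Ioi 0))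
    (hm_pos : ∀ t > 0, 0 < m t)
    (hm_lim : Tendsto m (nhdsWithin 0 (Set.Ioi 0)) (nhds 1))
    (hm_decay : ∃ C > 0, ∃ c > 0, ∀ t ≥ 1, m t ≤ C * t ^ (-(1 : ℝ) / 2) * Real.exp (-c * t))
    (I : ℝ → ℝ) (hI : ∀ γ ≥ 0, I γ = ∫ t in Set.Ioc 0 γ, m t)
    (Iinf : ℝ) (hIinf : Iinf = ∫ t in Set.Ioi 0, m t)
    (Mhat : ℝ → ℝ) (hMhat : ∀ x > 0, Mhat x = ∫ t in Set.Ioi 0, t ^ x * m t)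
    (Ibar : ℝ → ℝ) (hIbar : ∀ γ > 0, Ibar γ = ∫ a in Set.Ioi 0, f a * I (γ * a))
    (α₁ : ℝ)
    (hα₁ : α₁ = μ ^ μ * (1 + κ) ^ μ / (Real.exp (μ * κ) * Real.Gamma μ)) :
    -- `f` is a probability density on `(0,∞)`:
    (∀ a > 0, 0 ≤ f a) ∧ (∫ a in Set.Ioi 0, f a) = 1 ∧
    -- asymptotic expansion (diversity order `μ`, coding gain `((α₁/μ) M̂(μ))^{−1/μ}`):
    ∃ C' > 0, ∃ γ0 > 0, ∀ γ ≥ γ0,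
      |Ibar γ - Iinf + (α₁ / μ) * Mhat μ * γ ^ (-μ)| ≤ C' * γ ^ (-μ - 1) := by
  have hβ : 0 < μ * (1 + κ) := by positivity
  have hy : 0 < μ * κ := by positivity
  have hα' : ∀ n : ℕ, α n = (μ * (1 + κ)) ^ (μ + (n : ℝ)) * Real.exp (-(μ * κ)) *
      ((μ * κ) ^ n / n.factorial) / Real.Gamma (μ + n) := by
    intro n
    have hΓ : 0 < Real.Gamma (μ + n) := Real.Gamma_pos_of_pos (by positivity)
    rw [hα, Real.Gamma_nat_eq_factorial, Real.exp_neg, Real.mul_rpow hμ.le (by positivity),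
      two_mul, ← add_assoc, Real.rpow_add hμ, Real.rpow_natCast, mul_pow]
    field_simp
  have hα0 : α 0 = α₁ := by
    rw [hα, hα₁]
    simp
  have hfnn : ∀ a > 0, 0 ≤ f a := by
    intro a ha
    rw [hf a ha]
    refine tsum_nonneg fun n => ?_
    have hΓ : 0 < Real.Gamma (μ + n) := Real.Gamma_pos_of_pos (by positivity)
    rw [hα']
    positivity
  have hf1 : ∫ a in Set.Ioi 0, f a = 1 := by
    rw [setIntegral_congr_fun measurableSet_Ioi hf]
    exact integral_gamma_mixture hμ hβ hy hα'
  refine ⟨hfnn, hf1, ?_⟩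
  have hfint : IntegrableOn f (Ioi 0) := Integrable.of_integral_ne_zero (by simp [hf1])
  obtain ⟨K, hK⟩ := exists_abs_gamma_mixture_sub_le hμ hβ hy hα'
  have hmoment : ∀ {s : ℝ}, 0 ≤ s → IntegrableOn (fun t => t ^ s * m t) (Ioi 0) := fun hs =>
    integrableOn_rpow_mul_of_exp_decay_s9 hm_cont hm_pos hm_lim hm_decay hs
  have hm_int : IntegrableOn m (Ioi 0) := by simpa using hmoment le_rfl
  refine ⟨max (K * ((∫ t in Ioi 0, t ^ (μ + 1) * m t) / (μ + 1))) 1, by positivity, 1, one_pos,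
    fun γ hγ => ?_⟩
  have hγ0 : 0 < γ := lt_of_lt_of_le one_pos hγ
  have hI' : EqOn (fun a => f a * I (γ * a)) (fun a => f a * ∫ t in Ioc 0 (γ * a), m t)
      (Ioi 0) := fun a ha => by
    simp only [hI (γ * a) (mul_pos hγ0 ha).le]
  rw [hIbar γ hγ0, setIntegral_congr_fun measurableSet_Ioi hI', hIinf, hMhat μ hμ]
  refine (abs_integral_mul_integral_Ioc_sub_le hm_int (fun t ht => (hm_pos t ht).le) hμ
    (hmoment hμ.le) (hmoment (by linarith)) hfint hf1 (A := α₁) (K := K) ?_ hγ0).trans ?_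
  · intro a ha
    rw [hf a ha, ← hα0]
    exact hK a ha
  · exact mul_le_mul_of_nonneg_right (le_max_left _ _) (Real.rpow_nonneg hγ0.le _)
end

section
/- Let μ > 0 and let h, H be reals with 0 ≤ |H| < h. For i ≥ 1 set θ_i = 2√π μ^{2μ+2i−2} h^μ H^{2i−2} / (Γ(μ) Γ(i) Γ(μ+i−1/2)) (with H^0 interpreted as 1). Then Σ_{i=1}^∞ θ_i · Γ(2(μ−1+i)) · (2μh)^{−2(μ−1+i)} = h^μ 2^{2μ} μ^{2μ} / ((2μh)² − (2μH)²)^μ, the series converging absolutely. In particular, θ_1 divided by this sum equals 2√π μ^{2μ} (h² − H²)^μ / (Γ(μ) Γ(μ+1/2)). -/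
open Real Filter

theorem Real.Gamma_add_natCast_eq_ascPochhammer_eval_mul {a : ℝ} (ha : 0 < a) (n : ℕ) :
    Real.Gamma (a + n) = (ascPochhammer ℝ n).eval a * Real.Gamma a := by
  induction n with
  | zero => simp
  | succ n ih =>
    have h : a + n ≠ 0 := by positivity
    rw [ascPochhammer_succ_eval, Nat.cast_succ, ← add_assoc, Real.Gamma_add_one h, ih]
    ring

theorem Ring.choose_add_sub_one_eq_Gamma_div {a : ℝ} (ha : 0 < a) (n : ℕ) :
    Ring.choose (a + n - 1) n =
      Real.Gamma (a + n) / (Real.Gamma a * Real.Gamma ((n : ℝ) + 1)) := by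
  have hΓ := (Real.Gamma_pos_of_pos ha).ne'
  have hf : (n.factorial : ℝ) ≠ 0 := by positivity
  have h := Ring.factorial_nsmul_multichoose_eq_ascPochhammer a n
  rw [Polynomial.ascPochhammer_smeval_eq_eval, nsmul_eq_mul, Ring.multichoose_eq] at h
  rw [Real.Gamma_nat_eq_factorial, Real.Gamma_add_natCast_eq_ascPochhammer_eval_mul ha, ← h]
  field_simp

/-- The negative binomial series, with coefficients written through the gamma function. -/
theorem Real.hasSum_Gamma_mul_pow {a x : ℝ} (ha : 0 < a) (hx : |x| < 1) :
    HasSum (fun n : ℕ => Real.Gamma (a + n) / (Real.Gamma a * Real.Gamma ((n : ℝ) + 1)) * x ^ n)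
      (1 / (1 - x) ^ a) := by
  have h := (Real.one_div_one_sub_rpow_hasFPowerSeriesOnBall_zero a).hasSum (y := x)
    (by simpa [enorm_eq_nnnorm] using! hx)
  simpa [Ring.choose_add_sub_one_eq_Gamma_div ha, mul_comm] using h

/-- Legendre's duplication formula turns each term of the normalization series into a term of a
negative binomial series. -/
theorem eta_mu_term_eq {μ h : ℝ} (H : ℝ) (hμ : 0 < μ) (hh : 0 < h) (n : ℕ) :
    2 * √π * μ ^ (2 * μ + 2 * (n : ℝ)) * h ^ μ * H ^ (2 * n) /
        (Real.Gamma μ * Real.Gamma ((n : ℝ) + 1) * Real.Gamma (μ + (n : ℝ) + 1 / 2)) *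
      Real.Gamma (2 * (μ + (n : ℝ))) * (2 * μ * h) ^ (-(2 * (μ + (n : ℝ)))) =
    (h ^ μ)⁻¹ * (Real.Gamma (μ + n) / (Real.Gamma μ * Real.Gamma ((n : ℝ) + 1)) *
      (H ^ 2 / h ^ 2) ^ n) := by
  have hs : 0 < μ + n := by positivity
  have hΓμ := (Real.Gamma_pos_of_pos hμ).ne'
  have hΓn := (Real.Gamma_pos_of_pos (show (0 : ℝ) < n + 1 by positivity)).ne'
  have hΓs := (Real.Gamma_pos_of_pos (show 0 < μ + n + 1 / 2 by positivity)).ne'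
  have hpi : √π ≠ 0 := by positivity
  have hdup := Real.Gamma_mul_Gamma_add_half (μ + n)
  have hpow2 : (2 : ℝ) ^ (1 - 2 * (μ + n)) = 2 * (2 ^ (2 * (μ + (n : ℝ))))⁻¹ := by
    rw [Real.rpow_sub two_pos, Real.rpow_one, div_eq_mul_inv]
  have hpowh : h ^ (2 * (μ + (n : ℝ))) = h ^ μ * h ^ μ * (h ^ 2) ^ n := by
    rw [show 2 * (μ + (n : ℝ)) = μ + μ + ((2 * n : ℕ) : ℝ) by push_cast; ring,
      Real.rpow_add hh, Real.rpow_add hh, Real.rpow_natCast, pow_mul]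
  have hA : (2 : ℝ) ^ (2 * (μ + (n : ℝ))) ≠ 0 := by positivity
  have hB : μ ^ (2 * (μ + (n : ℝ))) ≠ 0 := by positivity
  have hC : h ^ μ ≠ 0 := by positivity
  rw [hpow2] at hdup
  rw [Real.rpow_neg (by positivity), Real.mul_rpow (by positivity) hh.le,
    Real.mul_rpow zero_le_two hμ.le, hpowh, ← mul_add, pow_mul, div_pow]
  have hdup' : Real.Gamma (2 * (μ + n)) = Real.Gamma (μ + n) * Real.Gamma (μ + n + 1 / 2) *
      2 ^ (2 * (μ + (n : ℝ))) / (2 * √π) := by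
    rw [hdup]
    field_simp
  rw [hdup']
  generalize (2 : ℝ) ^ (2 * (μ + (n : ℝ))) = A at *
  generalize μ ^ (2 * (μ + (n : ℝ))) = B at *
  generalize h ^ μ = C at *
  generalize Real.Gamma (μ + n + 1 / 2) = G at *
  generalize Real.Gamma (μ + n) = G' at *
  field_simp

/-- For `μ > 0` and `0 ≤ |H| < h`, with
`θ_i = 2√π μ^{2μ+2i−2} h^μ H^{2i−2} / (Γ(μ) Γ(i) Γ(μ+i−1/2))` for `i ≥ 1`
(indexing: the paper's `i ≥ 1` corresponds to `n = i - 1 : ℕ` below), one has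
`Σ_{i≥1} θ_i Γ(2(μ−1+i)) (2μh)^{−2(μ−1+i)} = h^μ 2^{2μ} μ^{2μ} / ((2μh)² − (2μH)²)^μ`,
the series converging absolutely; in particular `θ₁` divided by this sum equals
`2√π μ^{2μ} (h² − H²)^μ / (Γ(μ) Γ(μ+1/2))`. -/
theorem eta_mu_normalization_series
    (μ h H : ℝ) (hμ : 0 < μ) (hHh : |H| < h)
    (θ : ℕ → ℝ)
    (hθ : ∀ n : ℕ, θ n =
      2 * Real.sqrt Real.pi * μ ^ (2 * μ + 2 * (n : ℝ)) * h ^ μ * H ^ (2 * n) /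
        (Real.Gamma μ * Real.Gamma ((n : ℝ) + 1) * Real.Gamma (μ + (n : ℝ) + 1 / 2))) :
    Summable (fun n : ℕ =>
      |θ n * Real.Gamma (2 * (μ + (n : ℝ))) * (2 * μ * h) ^ (-(2 * (μ + (n : ℝ))))|) ∧
    (∑' n : ℕ, θ n * Real.Gamma (2 * (μ + (n : ℝ))) * (2 * μ * h) ^ (-(2 * (μ + (n : ℝ)))))
      = h ^ μ * 2 ^ (2 * μ) * μ ^ (2 * μ) / ((2 * μ * h) ^ 2 - (2 * μ * H) ^ 2) ^ μ ∧
    θ 0 / (∑' n : ℕ, θ n * Real.Gamma (2 * (μ + (n : ℝ))) *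
        (2 * μ * h) ^ (-(2 * (μ + (n : ℝ)))))
      = 2 * Real.sqrt Real.pi * μ ^ (2 * μ) * (h ^ 2 - H ^ 2) ^ μ /
          (Real.Gamma μ * Real.Gamma (μ + 1 / 2)) := by
  have hh : 0 < h := (abs_nonneg H).trans_lt hHh
  have hsq : H ^ 2 < h ^ 2 := by rwa [sq_lt_sq, abs_of_pos hh]
  have hd : 0 < h ^ 2 - H ^ 2 := sub_pos.mpr hsq
  have hx : |H ^ 2 / h ^ 2| < 1 := by
    rw [abs_of_nonneg (by positivity), div_lt_one (by positivity)]
    exact hsq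
  have hhμ : (h ^ 2) ^ μ = h ^ μ * h ^ μ := by
    rw [sq, Real.mul_rpow hh.le hh.le]
  have hC : h ^ μ ≠ 0 := by positivity
  have hD : (h ^ 2 - H ^ 2) ^ μ ≠ 0 := by positivity
  have hval : (h ^ μ)⁻¹ * (1 / (1 - H ^ 2 / h ^ 2) ^ μ) = h ^ μ / (h ^ 2 - H ^ 2) ^ μ := by
    rw [one_sub_div (by positivity), Real.div_rpow hd.le (by positivity), hhμ]
    field_simp
  have hsum : HasSum (fun n : ℕ =>
      θ n * Real.Gamma (2 * (μ + (n : ℝ))) * (2 * μ * h) ^ (-(2 * (μ + (n : ℝ)))))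
      (h ^ μ / (h ^ 2 - H ^ 2) ^ μ) := by
    simp_rw [hθ, eta_mu_term_eq H hμ hh]
    rw [← hval]
    exact (Real.hasSum_Gamma_mul_pow hμ hx).mul_left _
  refine ⟨hsum.summable.abs, ?_, ?_⟩
  · rw [hsum.tsum_eq, show (2 * μ * h) ^ 2 - (2 * μ * H) ^ 2 = (2 * μ) ^ 2 * (h ^ 2 - H ^ 2) by ring,
      Real.mul_rpow (by positivity) hd.le, mul_assoc (h ^ μ), ← Real.mul_rpow zero_le_two hμ.le,
      Real.rpow_mul (by positivity), Real.rpow_two]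
    have hE : ((2 * μ) ^ 2) ^ μ ≠ 0 := by positivity
    field_simp
  · rw [hsum.tsum_eq, hθ]
    simp only [Nat.cast_zero, mul_zero, add_zero, pow_zero, mul_one, zero_add, Real.Gamma_one]
    field_simp
end

section
/- (Asymptotically optimal power allocation, distinct diversity orders.) In the power allocation setting, let S = Σ_{l : D_l = D_min} A_l^{1/(D_min+1)} and c = D_min · S^{D_min+1}. Then: (i) for every k with D_k = D_min, lim_{γ̄→∞} p*_k(γ̄) = A_k^{1/(D_min+1)} / S; and (ii) for every k with D_k > D_min, lim_{γ̄→∞} p*_k(γ̄) · γ̄^{(D_k − D_min)/(D_k+1)} = (A_k D_k / c)^{1/(D_k+1)}; in particular p*_k(γ̄) → 0 as γ̄ → ∞ for every k with D_k > D_min. -/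
open MeasureTheory Real Filter Set

open scoped Topology

/-- The derivative of a strictly concave function on a half-line is strictly decreasing. -/
lemma strictAntiOn_of_strictConcaveOn_of_hasDerivAt {f g : ℝ → ℝ}
    (hf : ∀ x > (0 : ℝ), HasDerivAt f (g x) x) (hconc : StrictConcaveOn ℝ (Ioi 0) f) :
    StrictAntiOn g (Ioi 0) := by
  intro x hx y hy hxy
  have h := hconc.strictAntiOn_deriv (fun z hz => (hf z hz).differentiableAt) hx hy hxy
  rwa [(hf x hx).deriv, (hf y hy).deriv] at h

lemma pos_of_strictMonoOn_of_strictAntiOn {f g : ℝ → ℝ}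
    (hcont : ContinuousOn f (Ici 0)) (hf : ∀ x > (0 : ℝ), HasDerivAt f (g x) x)
    (hmono : StrictMonoOn f (Ici 0)) (hg : StrictAntiOn g (Ioi 0)) {x : ℝ} (hx : 0 < x) :
    0 < g x := by
  obtain ⟨z, hz, hgz⟩ := exists_hasDerivAt_eq_slope f g (lt_add_one x)
    (hcont.mono fun y hy => hx.le.trans hy.1) fun y hy => hf y (hx.trans hy.1)
  have hlt := hmono (mem_Ici.2 hx.le) (mem_Ici.2 (by linarith : (0 : ℝ) ≤ x + 1)) (lt_add_one x)
  have hpos : 0 < g z := hgz ▸ div_pos (sub_pos.2 hlt) (by linarith)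
  exact hpos.trans (hg hx (hx.trans hz.1) hz.1)

lemma lt_of_strictAntiOn_of_tendsto {g : ℝ → ℝ} {L : ℝ} (hg : StrictAntiOn g (Ioi 0))
    (hlim : Tendsto g (𝓝[>] 0) (𝓝 L)) {x : ℝ} (hx : 0 < x) : g x < L := by
  have hx2 : 0 < x / 2 := half_pos hx
  refine (hg hx2 hx (half_lt_self hx)).trans_le (ge_of_tendsto hlim ?_)
  filter_upwards [Ioo_mem_nhdsGT hx2] with y hy
  exact (hg hy.1 hx2 hy.2).le

/-- If moving mass from `a` to `b` always decreases `f₁ a + f₂ b`, then the marginal gain at `b`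
does not exceed the marginal gain at `a`. -/
lemma marginal_le_of_transfer_lt {f₁ g₁ f₂ g₂ : ℝ → ℝ}
    (hcont₁ : ContinuousOn f₁ (Ici 0)) (hf₁ : ∀ x > (0 : ℝ), HasDerivAt f₁ (g₁ x) x)
    (hgcont₁ : ContinuousOn g₁ (Ioi 0)) (hg₁ : StrictAntiOn g₁ (Ioi 0))
    (hcont₂ : ContinuousOn f₂ (Ici 0)) (hf₂ : ∀ x > (0 : ℝ), HasDerivAt f₂ (g₂ x) x)
    (hg₂ : StrictAntiOn g₂ (Ioi 0)) {a b L : ℝ} (ha : 0 < a) (hb : 0 ≤ b)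
    (hL : Tendsto g₂ (𝓝[>] b) (𝓝 L))
    (h : ∀ s, 0 < s → s < a → f₁ (a - s) + f₂ (b + s) < f₁ a + f₂ b) : L ≤ g₁ a := by
  have hlim₁ : Tendsto (fun s => g₁ (a - s)) (𝓝[>] 0) (𝓝 (g₁ a)) := by
    have h1 : Tendsto (fun s : ℝ => a - s) (𝓝[>] 0) (𝓝 a) := by
      have : Tendsto (fun s : ℝ => a - s) (𝓝 0) (𝓝 (a - 0)) := by
        exact (continuous_const.sub continuous_id).tendsto 0
      rw [sub_zero] at this
      exact this.mono_left nhdsWithin_le_nhds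
    exact (hgcont₁.continuousAt (Ioi_mem_nhds ha)).tendsto.comp h1
  have hlim₂ : Tendsto (fun s => g₂ (b + s)) (𝓝[>] 0) (𝓝 L) := by
    refine hL.comp (tendsto_nhdsWithin_iff.2 ⟨?_, ?_⟩)
    · have : Tendsto (fun s : ℝ => b + s) (𝓝 0) (𝓝 (b + 0)) := by
        exact (continuous_const.add continuous_id).tendsto 0
      rw [add_zero] at this
      exact this.mono_left nhdsWithin_le_nhds
    · filter_upwards [self_mem_nhdsWithin] with s hs
      exact lt_add_of_pos_right b hs
  refine le_of_tendsto_of_tendsto hlim₂ hlim₁ ?_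
  filter_upwards [Ioo_mem_nhdsGT ha] with s hs
  obtain ⟨hs0, hsa⟩ := hs
  obtain ⟨u, hu, hgu⟩ := exists_hasDerivAt_eq_slope f₁ g₁ (sub_lt_self a hs0)
    (hcont₁.mono fun y hy => (sub_pos.2 hsa).le.trans hy.1)
    fun y hy => hf₁ y ((sub_pos.2 hsa).trans hy.1)
  obtain ⟨v, hv, hgv⟩ := exists_hasDerivAt_eq_slope f₂ g₂ (lt_add_of_pos_right b hs0)
    (hcont₂.mono fun y hy => hb.trans hy.1) fun y hy => hf₂ y (hb.trans_lt hy.1)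
  rw [sub_sub_cancel] at hgu
  rw [add_sub_cancel_left] at hgv
  have hvu : g₂ v < g₁ u := by
    rw [hgu, hgv]
    exact div_lt_div_of_pos_right (by linarith [h s hs0 hsa]) hs0
  have h1 := hg₁ (mem_Ioi.2 (sub_pos.2 hsa)) (mem_Ioi.2 ((sub_pos.2 hsa).trans hu.1)) hu.1
  have h2 := hg₂ (mem_Ioi.2 (hb.trans_lt hv.1)) (mem_Ioi.2 (by linarith)) hv.2
  exact (h2.trans (hvu.trans h1)).le

/-- Compare a maximizer over the simplex with the allocation obtained by moving mass `s / γ`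
from coordinate `i` to coordinate `j`. -/
lemma transfer_lt_of_isMaximizer {ι : Type*} [Fintype ι] {f : ι → ℝ → ℝ} {γ : ℝ}
    (hγ : 0 < γ) {p : ι → ℝ} (hp : ∀ k, 0 ≤ p k) (hsum : ∑ k, p k = 1)
    (hmax : ∀ q : ι → ℝ, (∀ k, 0 ≤ q k) → ∑ k, q k = 1 → q ≠ p →
      ∑ k, f k (γ * q k) < ∑ k, f k (γ * p k))
    {i j : ι} (hij : i ≠ j) {s : ℝ} (hs : 0 < s) (hsi : s < γ * p i) :
    f i (γ * p i - s) + f j (γ * p j + s) < f i (γ * p i) + f j (γ * p j) := by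
  classical
  have hsγ : s / γ < p i := by rwa [div_lt_iff₀' hγ]
  have hsγ0 : 0 < s / γ := div_pos hs hγ
  set q : ι → ℝ := fun k => if k = i then p i - s / γ else if k = j then p j + s / γ else p k
    with hq
  have hqi : q i = p i - s / γ := by simp [hq]
  have hqj : q j = p j + s / γ := by simp [hq, hij.symm]
  have hqk : ∀ k, k ≠ i → k ≠ j → q k = p k := fun k h1 h2 => by simp [hq, h1, h2]
  have hsplit : ∀ F : ι → ℝ, ∑ k, F k = F i + (F j + ∑ k ∈ (Finset.univ.erase i).erase j, F k) := by
    intro F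
    rw [Finset.add_sum_erase _ _ (by simp [hij.symm]), Finset.add_sum_erase _ _ (by simp)]
  have hrest : ∀ F : ι → ℝ → ℝ, ∑ k ∈ (Finset.univ.erase i).erase j, F k (q k) =
      ∑ k ∈ (Finset.univ.erase i).erase j, F k (p k) := by
    intro F
    refine Finset.sum_congr rfl fun k hk => ?_
    simp only [Finset.mem_erase, Finset.mem_univ, and_true] at hk
    rw [hqk k hk.2 hk.1]
  have hlt := hmax q ?_ ?_ ?_
  · rw [hsplit, hsplit (fun k => f k (γ * p k)), hrest (fun k x => f k (γ * x)), hqi, hqj,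
      mul_sub, mul_add, mul_div_cancel₀ _ hγ.ne'] at hlt
    linarith
  · intro k
    by_cases h1 : k = i
    · rw [h1, hqi]; linarith
    by_cases h2 : k = j
    · rw [h2, hqj]; linarith [hp j]
    · rw [hqk k h1 h2]; exact hp k
  · rw [hsplit] at hsum ⊢
    rw [hrest (fun _ x => x), hqi, hqj]
    linarith
  · intro h
    have := congrFun h i
    rw [hqi] at this
    linarith

/-- A maximizer over the simplex has positive coordinates and equal marginals. -/
lemma pos_and_marginal_eq_of_isMaximizer {ι : Type*} [Fintype ι] {f g : ι → ℝ → ℝ}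
    (hcont : ∀ k, ContinuousOn (f k) (Ici 0))
    (hf : ∀ k, ∀ x > (0 : ℝ), HasDerivAt (f k) (g k x) x)
    (hgcont : ∀ k, ContinuousOn (g k) (Ioi 0)) (hg : ∀ k, StrictAntiOn (g k) (Ioi 0))
    (hlim : ∀ k, Tendsto (g k) (𝓝[>] 0) (𝓝 1)) {γ : ℝ}
    (hγ : 0 < γ) {p : ι → ℝ} (hp : ∀ k, 0 ≤ p k) (hsum : ∑ k, p k = 1)
    (hmax : ∀ q : ι → ℝ, (∀ k, 0 ≤ q k) → ∑ k, q k = 1 → q ≠ p →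
      ∑ k, f k (γ * q k) < ∑ k, f k (γ * p k)) :
    (∀ k, 0 < p k) ∧ ∀ i j, g i (γ * p i) = g j (γ * p j) := by
  have hpos : ∀ k, 0 < p k := by
    intro j
    by_contra hj
    have hj0 : p j = 0 := le_antisymm (not_lt.1 hj) (hp j)
    obtain ⟨i, -, hi⟩ : ∃ i ∈ Finset.univ, 0 < p i := by
      refine Finset.exists_lt_of_sum_lt (f := fun _ => (0 : ℝ)) ?_
      simp [hsum]
    have hij : i ≠ j := by rintro rfl; exact hj hi
    have hxi : 0 < γ * p i := mul_pos hγ hi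
    refine absurd ?_ (lt_of_strictAntiOn_of_tendsto (hg i) (hlim i) hxi).not_ge
    refine marginal_le_of_transfer_lt (hcont i) (hf i) (hgcont i) (hg i) (hcont j) (hf j) (hg j)
      hxi le_rfl (hlim j) fun s hs hsi => ?_
    simpa [hj0] using transfer_lt_of_isMaximizer hγ hp hsum hmax hij hs hsi
  have hle : ∀ i j, g j (γ * p j) ≤ g i (γ * p i) := by
    intro i j
    rcases eq_or_ne i j with rfl | hij
    · exact le_rfl
    have hxj := mul_pos hγ (hpos j)
    refine marginal_le_of_transfer_lt (hcont i) (hf i) (hgcont i) (hg i) (hcont j) (hf j) (hg j)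
      (mul_pos hγ (hpos i)) hxj.le ?_ fun s hs hsi =>
        transfer_lt_of_isMaximizer hγ hp hsum hmax hij hs hsi
    exact ((hgcont j).continuousAt (Ioi_mem_nhds hxj)).tendsto.mono_left nhdsWithin_le_nhds
  exact ⟨hpos, fun i j => le_antisymm (hle j i) (hle i j)⟩

lemma tendsto_mul_rpow_of_abs_sub_le {g : ℝ → ℝ} {a D C x₀ : ℝ}
    (h : ∀ x ≥ x₀, |g x - a * x ^ (-D - 1)| ≤ C * x ^ (-D - 2)) :
    Tendsto (fun x => g x * x ^ (D + 1)) atTop (𝓝 a) := by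
  rw [tendsto_iff_norm_sub_tendsto_zero]
  refine squeeze_zero' (Eventually.of_forall fun _ => norm_nonneg _) ?_
    (g := fun x => C * x⁻¹) (by simpa using tendsto_inv_atTop_zero.const_mul C)
  filter_upwards [eventually_ge_atTop x₀, eventually_gt_atTop 0] with x hx hx0
  have h1 : x ^ (-D - 1) * x ^ (D + 1) = 1 := by
    rw [← rpow_add hx0]; ring_nf; simp
  have h2 : x ^ (-D - 2) * x ^ (D + 1) = x⁻¹ := by
    rw [← rpow_add hx0, ← rpow_neg_one]; ring_nf
  have hp : 0 < x ^ (D + 1) := rpow_pos_of_pos hx0 _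
  calc ‖g x * x ^ (D + 1) - a‖ = |g x - a * x ^ (-D - 1)| * x ^ (D + 1) := by
        rw [Real.norm_eq_abs, ← abs_of_pos hp, ← abs_mul, abs_of_pos hp, sub_mul, mul_assoc a, h1,
          mul_one]
    _ ≤ C * x ^ (-D - 2) * x ^ (D + 1) := by gcongr; exact h x hx
    _ = C * x⁻¹ := by rw [mul_assoc, h2]

lemma tendsto_zero_of_tendsto_mul_rpow {g : ℝ → ℝ} {a d : ℝ} (hd : 0 < d)
    (h : Tendsto (fun x => g x * x ^ d) atTop (𝓝 a)) : Tendsto g atTop (𝓝 0) := by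
  have := h.mul (tendsto_rpow_neg_atTop hd)
  rw [mul_zero] at this
  refine this.congr' ?_
  filter_upwards [eventually_gt_atTop 0] with x hx
  rw [mul_assoc, ← rpow_add hx, add_neg_cancel, rpow_zero, mul_one]

/-- Inverting `g y ~ a * y ^ (-d)` along a load `x` with marginal `g (x t) = l t`. -/
lemma tendsto_load_mul_rpow {α : Type*} {F : Filter α} {g : ℝ → ℝ} {a d : ℝ} (hd : 0 < d)
    {x l : α → ℝ} (hx : Tendsto x F atTop) (hl : ∀ᶠ t in F, 0 < l t)
    (hgl : ∀ᶠ t in F, g (x t) = l t) (ha : 0 < a)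
    (h : Tendsto (fun y => g y * y ^ d) atTop (𝓝 a)) :
    Tendsto (fun t => x t * l t ^ (1 / d)) F (𝓝 (a ^ (1 / d))) := by
  have h1 := (h.comp hx).rpow_const (p := 1 / d) (Or.inl ha.ne')
  refine h1.congr' ?_
  filter_upwards [hl, hgl, hx.eventually_gt_atTop 0] with t ht hgt hxt
  simp only [Function.comp_apply]
  rw [hgt, mul_rpow ht.le (rpow_nonneg hxt.le _), ← rpow_mul hxt.le, mul_one_div_cancel hd.ne',
    rpow_one, mul_comm]

/-- Rescaled by `l ^ (1 / m)`, only the terms of smallest exponent `d k = m` contribute to the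
limit of the total load. -/
lemma tendsto_total_mul_rpow {ι α : Type*} [Fintype ι] {F : Filter α} {a d : ι → ℝ} {m : ℝ}
    (hm : 0 < m) (hmd : ∀ k, m ≤ d k) {x : ι → α → ℝ} {l : α → ℝ}
    (hl : ∀ᶠ t in F, 0 < l t) (hl0 : Tendsto l F (𝓝 0))
    (hx : ∀ k, Tendsto (fun t => x k t * l t ^ (1 / d k)) F (𝓝 (a k ^ (1 / d k)))) :
    Tendsto (fun t => (∑ k, x k t) * l t ^ (1 / m)) F
      (𝓝 (∑ k ∈ Finset.univ.filter (fun k => d k = m), a k ^ (1 / m))) := by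
  simp_rw [Finset.sum_mul, Finset.sum_filter]
  refine tendsto_finsetSum _ fun k _ => ?_
  split_ifs with hk
  · simpa [hk] using hx k
  · have hlt : m < d k := lt_of_le_of_ne (hmd k) (Ne.symm hk)
    have he : 0 < 1 / m - 1 / d k := sub_pos.2 (one_div_lt_one_div_of_lt hm hlt)
    have h0 : Tendsto (fun t => l t ^ (1 / m - 1 / d k)) F (𝓝 0) := by
      simpa only [zero_rpow he.ne'] using hl0.rpow_const (p := 1 / m - 1 / d k) (Or.inr he.le)
    have := (hx k).mul h0
    rw [mul_zero] at this
    refine this.congr' ?_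
    filter_upwards [hl] with t ht
    rw [mul_assoc, ← rpow_add ht, add_sub_cancel]

/-- **Asymptotically optimal power allocation, distinct diversity orders.**
In the power allocation setting, with `S = Σ_{l : D_l = D_min} A_l^{1/(D_min+1)}` and
`c = D_min S^{D_min+1}`: (i) for every `k` with `D_k = D_min`,
`p*_k(γ̄) → A_k^{1/(D_min+1)}/S`; (ii) for every `k` with `D_k > D_min`,
`p*_k(γ̄) γ̄^{(D_k−D_min)/(D_k+1)} → (A_k D_k/c)^{1/(D_k+1)}`, and in particular
`p*_k(γ̄) → 0`. -/
theorem asymptotic_power_allocation_distinct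
    (K : ℕ) (hK : 0 < K)
    (Ibar Ibar' : Fin K → ℝ → ℝ)
    (hcont : ∀ k, ContinuousOn (Ibar k) (Set.Ici 0))
    (hmono : ∀ k, StrictMonoOn (Ibar k) (Set.Ici 0))
    (hderiv : ∀ k, ∀ x > (0 : ℝ), HasDerivAt (Ibar k) (Ibar' k x) x)
    (hderiv_cont : ∀ k, ContinuousOn (Ibar' k) (Set.Ioi 0))
    (hconc : ∀ k, StrictConcaveOn ℝ (Set.Ioi 0) (Ibar k))
    (hlim0 : ∀ k, Tendsto (Ibar' k) (nhdsWithin 0 (Set.Ioi 0)) (nhds 1))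
    (A D : Fin K → ℝ) (hA : ∀ k, 0 < A k) (hD : ∀ k, 0 < D k)
    (hasymp : ∀ k, ∃ C > 0, ∃ x0 > 0, ∀ x ≥ x0,
      |Ibar' k x - A k * D k * x ^ (-(D k) - 1)| ≤ C * x ^ (-(D k) - 2))
    (pstar : ℝ → Fin K → ℝ)
    (hpstar : ∀ γ > (0 : ℝ),
      ((∀ k, 0 ≤ pstar γ k) ∧ ∑ k, pstar γ k = 1) ∧
      ∀ q : Fin K → ℝ, (∀ k, 0 ≤ q k) → (∑ k, q k = 1) → q ≠ pstar γ →
        ∑ k, Ibar k (γ * q k) < ∑ k, Ibar k (γ * pstar γ k))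
    (Dmin : ℝ) (hDmin : IsLeast (Set.range D) Dmin)
    (S : ℝ)
    (hS : S = ∑ k ∈ Finset.univ.filter (fun k => D k = Dmin),
      (A k) ^ ((1 : ℝ) / (Dmin + 1)))
    (c : ℝ) (hc : c = Dmin * S ^ (Dmin + 1)) :
    (∀ k, D k = Dmin →
      Tendsto (fun γ => pstar γ k) atTop (nhds ((A k) ^ ((1 : ℝ) / (Dmin + 1)) / S))) ∧
    (∀ k, Dmin < D k →
      Tendsto (fun γ => pstar γ k * γ ^ ((D k - Dmin) / (D k + 1))) atTop
          (nhds ((A k * D k / c) ^ ((1 : ℝ) / (D k + 1)))) ∧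
      Tendsto (fun γ => pstar γ k) atTop (nhds 0)) := by
  have hg : ∀ k, StrictAntiOn (Ibar' k) (Ioi 0) := fun k =>
    strictAntiOn_of_strictConcaveOn_of_hasDerivAt (hderiv k) (hconc k)
  have hgpos : ∀ k x, 0 < x → 0 < Ibar' k x := fun k x hx =>
    pos_of_strictMonoOn_of_strictAntiOn (hcont k) (hderiv k) (hmono k) (hg k) hx
  have hkkt : ∀ γ > (0 : ℝ), (∀ k, 0 < pstar γ k) ∧
      ∀ i j, Ibar' i (γ * pstar γ i) = Ibar' j (γ * pstar γ j) := fun γ hγ =>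
    pos_and_marginal_eq_of_isMaximizer hcont hderiv hderiv_cont hg hlim0 hγ
      (hpstar γ hγ).1.1 (hpstar γ hγ).1.2 (hpstar γ hγ).2
  obtain ⟨k₀, hk₀⟩ := hDmin.1
  have hle : ∀ k, Dmin ≤ D k := fun k => hDmin.2 ⟨k, rfl⟩
  have hDmin0 : 0 < Dmin := hk₀ ▸ hD k₀
  have hm : 0 < Dmin + 1 := by linarith
  have hd : ∀ k, 0 < D k + 1 := fun k => by linarith [hD k]
  have hrate : ∀ k, Tendsto (fun x => Ibar' k x * x ^ (D k + 1)) atTop (𝓝 (A k * D k)) := by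
    intro k
    obtain ⟨C, -, x₀, -, h⟩ := hasymp k
    exact tendsto_mul_rpow_of_abs_sub_le h
  set l : ℝ → ℝ := fun γ => Ibar' k₀ (γ * pstar γ k₀)
  have hgl : ∀ k, ∀ᶠ γ in atTop, Ibar' k (γ * pstar γ k) = l γ := by
    intro k
    filter_upwards [eventually_gt_atTop 0] with γ hγ
    exact (hkkt γ hγ).2 k k₀
  have hl : ∀ᶠ γ in atTop, 0 < l γ := by
    filter_upwards [eventually_gt_atTop 0] with γ hγ
    exact hgpos k₀ _ (mul_pos hγ ((hkkt γ hγ).1 k₀))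
  have hKpos : (0 : ℝ) < K := by exact_mod_cast hK
  have hl0 : Tendsto l atTop (𝓝 0) := by
    have hbound : Tendsto (fun γ : ℝ => ∑ k, Ibar' k (γ / K)) atTop (𝓝 0) := by
      have := tendsto_finsetSum Finset.univ fun k _ =>
        (tendsto_zero_of_tendsto_mul_rpow (hd k) (hrate k)).comp
          (tendsto_id.atTop_div_const hKpos)
      simpa using this
    refine squeeze_zero' (hl.mono fun _ h => h.le) ?_ hbound
    filter_upwards [eventually_gt_atTop 0] with γ hγ
    obtain ⟨i, -, hi⟩ : ∃ i ∈ Finset.univ, 1 / (K : ℝ) ≤ pstar γ i := by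
      refine Finset.exists_le_of_sum_le ⟨k₀, Finset.mem_univ _⟩ ?_
      simp [(hpstar γ hγ).1.2, hKpos.ne']
    have hγK : 0 < γ / K := div_pos hγ hKpos
    have hxi : γ / K ≤ γ * pstar γ i := by
      rw [div_eq_mul_one_div]
      gcongr
    calc l γ = Ibar' i (γ * pstar γ i) := (hkkt γ hγ).2 k₀ i
      _ ≤ Ibar' i (γ / K) := (hg i).antitoneOn hγK (hγK.trans_le hxi) hxi
      _ ≤ ∑ k, Ibar' k (γ / K) :=
        Finset.single_le_sum (fun k _ => (hgpos k _ hγK).le) (Finset.mem_univ i)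
  have hx : ∀ k, Tendsto (fun γ => γ * pstar γ k) atTop atTop := by
    intro k
    refine tendsto_atTop.2 fun b => ?_
    have hb : (0 : ℝ) < max b 1 := by positivity
    filter_upwards [eventually_gt_atTop 0, hgl k, hl0.eventually_lt_const (hgpos k _ hb)]
      with γ hγ hγl hlt
    refine (le_max_left b 1).trans (le_of_not_gt fun hcon => ?_)
    have := hg k (mul_pos hγ ((hkkt γ hγ).1 k)) hb hcon
    linarith
  have hload : ∀ k, Tendsto (fun γ => γ * pstar γ k * l γ ^ (1 / (D k + 1))) atTop
      (𝓝 ((A k * D k) ^ (1 / (D k + 1)))) := fun k =>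
    tendsto_load_mul_rpow (hd k) (hx k) hl (hgl k) (mul_pos (hA k) (hD k)) (hrate k)
  have hSpos : 0 < S := by
    rw [hS]
    exact Finset.sum_pos (fun k _ => rpow_pos_of_pos (hA k) _) ⟨k₀, by simp [hk₀]⟩
  have hcpos : 0 < c := hc ▸ mul_pos hDmin0 (rpow_pos_of_pos hSpos _)
  have hcroot : Dmin ^ (1 / (Dmin + 1)) * S = c ^ (1 / (Dmin + 1)) := by
    rw [hc, mul_rpow hDmin0.le (rpow_nonneg hSpos.le _), ← rpow_mul hSpos.le,
      mul_one_div_cancel hm.ne', rpow_one]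
  have htotal : Tendsto (fun γ => γ * l γ ^ (1 / (Dmin + 1))) atTop
      (𝓝 (Dmin ^ (1 / (Dmin + 1)) * S)) := by
    have h := tendsto_total_mul_rpow (d := fun k => D k + 1) hm
      (fun k => by linarith [hle k]) hl hl0 hload
    have hsum : ∑ k ∈ Finset.univ.filter (fun k => D k + 1 = Dmin + 1),
        (A k * D k) ^ (1 / (Dmin + 1)) = Dmin ^ (1 / (Dmin + 1)) * S := by
      simp only [add_left_inj]
      rw [hS, Finset.mul_sum]
      refine Finset.sum_congr rfl fun k hk => ?_
      rw [(Finset.mem_filter.1 hk).2, mul_rpow (hA k).le hDmin0.le, mul_comm]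
    rw [hsum] at h
    refine h.congr' ?_
    filter_upwards [eventually_gt_atTop 0] with γ hγ
    rw [← Finset.mul_sum, (hpstar γ hγ).1.2, mul_one]
  refine ⟨fun k hk => ?_, fun k hk => ?_⟩
  · have h := (hload k).div htotal (by positivity)
    have hlim : (A k * D k) ^ (1 / (D k + 1)) / (Dmin ^ (1 / (Dmin + 1)) * S) =
        A k ^ (1 / (Dmin + 1)) / S := by
      rw [hk, mul_rpow (hA k).le hDmin0.le, mul_comm,
        mul_div_mul_left _ _ (rpow_pos_of_pos hDmin0 _).ne']
    rw [hlim] at h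
    refine h.congr' ?_
    filter_upwards [eventually_gt_atTop 0, hl] with γ hγ hlγ
    have := (rpow_pos_of_pos hlγ (1 / (Dmin + 1))).ne'
    rw [Pi.div_apply, hk]
    field_simp
  · have hmain : Tendsto (fun γ => pstar γ k * γ ^ ((D k - Dmin) / (D k + 1))) atTop
        (𝓝 ((A k * D k / c) ^ ((1 : ℝ) / (D k + 1)))) := by
      have hpow := htotal.rpow_const (p := (Dmin + 1) / (D k + 1)) (Or.inl (by positivity))
      rw [hcroot, ← rpow_mul hcpos.le, div_mul_div_cancel₀ hm.ne'] at hpow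
      have h := (hload k).div hpow (rpow_pos_of_pos hcpos _).ne'
      rw [← div_rpow (mul_pos (hA k) (hD k)).le hcpos.le] at h
      refine h.congr' ?_
      filter_upwards [eventually_gt_atTop 0, hl] with γ hγ hlγ
      have hlne := (rpow_pos_of_pos hlγ (1 / (D k + 1))).ne'
      have hexp : (D k - Dmin) / (D k + 1) = 1 - (Dmin + 1) / (D k + 1) := by
        have := (hd k).ne'
        field_simp
        ring
      rw [Pi.div_apply, mul_rpow hγ.le (rpow_nonneg hlγ.le _), ← rpow_mul hlγ.le,
        div_mul_div_cancel₀ hm.ne', mul_div_mul_right _ _ hlne, hexp, rpow_sub hγ, rpow_one]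
      ring
    refine ⟨hmain, ?_⟩
    have he : 0 < (D k - Dmin) / (D k + 1) := div_pos (sub_pos.2 hk) (hd k)
    have h := hmain.mul (tendsto_rpow_neg_atTop he)
    rw [mul_zero] at h
    refine h.congr' ?_
    filter_upwards [eventually_gt_atTop 0] with γ hγ
    rw [mul_assoc, ← rpow_add hγ, add_neg_cancel, rpow_zero, mul_one]
end

section
/- (Asymptotically optimal power allocation, common diversity order.) In the power allocation setting, suppose all diversity orders are equal: D_k = D for every k = 1,…,K. Then, as γ̄ → ∞, p*_k(γ̄) = A_k^{1/(D+1)} / (Σ_{l=1}^K A_l^{1/(D+1)}) + O(γ̄^{−1}) for every k; that is, there exist constants C > 0 and γ_0 > 0 such that |p*_k(γ̄) − A_k^{1/(D+1)}/Σ_{l=1}^K A_l^{1/(D+1)}| ≤ C γ̄^{−1} for all γ̄ ≥ γ_0 and all k. -/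
open MeasureTheory Real Filter Set

/-- If `f` and `g` both decay like `d * s ^ (-d - 1)` up to an error `O(s ^ (-d - 2))`, then a
suitable fixed shift of the argument makes `f` eventually smaller than `g`. -/
lemma exists_shift_lt_of_rpow_asymp {d : ℝ} (hd : 0 < d) {f g : ℝ → ℝ}
    (hf : ∃ C > 0, ∃ s0 > 0, ∀ s ≥ s0, |f s - d * s ^ (-d - 1)| ≤ C * s ^ (-d - 2))
    (hg : ∃ C > 0, ∃ s0 > 0, ∀ s ≥ s0, |g s - d * s ^ (-d - 1)| ≤ C * s ^ (-d - 2)) :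
    ∃ M > 0, ∃ T > 0, ∀ s ≥ T, f (s + M) < g s := by
  obtain ⟨Cf, hCf, sf, hsf, hf⟩ := hf
  obtain ⟨Cg, hCg, sg, hsg, hg⟩ := hg
  set B : ℝ := (2 : ℝ) ^ (d + 1)
  have hB : 0 < B := by positivity
  obtain ⟨M, hM⟩ : ∃ M, M = (Cg * B + Cf + 1) / d := ⟨_, rfl⟩
  have hMpos : 0 < M := by rw [hM]; positivity
  have hdM : d * M = Cg * B + Cf + 1 := by rw [hM]; field_simp
  refine ⟨M, hMpos, max M (max sf sg), lt_max_of_lt_left hMpos, fun s hs => ?_⟩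
  have hsM : M ≤ s := (le_max_left _ _).trans hs
  have hs1 : sf ≤ s := (le_max_left _ _).trans ((le_max_right _ _).trans hs)
  have hs2 : sg ≤ s := (le_max_right _ _).trans ((le_max_right _ _).trans hs)
  have hspos : 0 < s := hMpos.trans_le hsM
  have hupos : 0 < s + M := by linarith
  have hf' := (abs_le.mp (hf (s + M) (by linarith))).2
  have hg' := (abs_le.mp (hg s hs2)).1
  have hsplit : ∀ t : ℝ, 0 < t → t ^ (-d - 2) = t ^ (-d - 1) / t := fun t ht => by
    rw [show -d - 2 = (-d - 1) - 1 by ring, Real.rpow_sub_one ht.ne']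
  rw [hsplit _ hupos] at hf'
  rw [hsplit _ hspos] at hg'
  have hratio : s ^ (-d - 1) = (s + M) ^ (-d - 1) * ((s + M) / s) ^ (d + 1) := by
    rw [Real.div_rpow hupos.le hspos.le, show -d - 1 = -(d + 1) by ring,
      Real.rpow_neg hupos.le, Real.rpow_neg hspos.le]
    have := Real.rpow_pos_of_pos hupos (d + 1)
    field_simp
  set U := (s + M) ^ (-d - 1)
  have hU : 0 < U := Real.rpow_pos_of_pos hupos _
  have hone : 1 ≤ (s + M) / s := by rw [one_le_div hspos]; linarith
  have hlow : 1 + M / s ≤ ((s + M) / s) ^ (d + 1) := by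
    calc 1 + M / s = ((s + M) / s) ^ (1 : ℝ) := by rw [Real.rpow_one]; field_simp
      _ ≤ _ := Real.rpow_le_rpow_of_exponent_le hone (by linarith)
  have hup : ((s + M) / s) ^ (d + 1) ≤ B :=
    Real.rpow_le_rpow (by linarith) (by rw [div_le_iff₀ hspos]; linarith) (by linarith)
  rw [hratio] at hg'
  set R := ((s + M) / s) ^ (d + 1)
  have h1 : d * (U * (1 + M / s)) ≤ d * (U * R) := by gcongr
  have h2 : Cg * (U * R / s) ≤ Cg * (U * B / s) := by gcongr
  have h3 : Cf * (U / (s + M)) ≤ Cf * (U / s) := by gcongr; linarith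
  have h4 : d * (U * (1 + M / s)) - Cg * (U * B / s) - Cf * (U / s) = d * U + U / s := by
    have : d * (U * (1 + M / s)) = d * U + (d * M) * (U / s) := by ring
    rw [this, hdM]; ring
  have h5 : 0 < U / s := by positivity
  linarith

/-- Rescaling the argument by `A ^ (1 / (d + 1))` normalizes the leading coefficient of a
power-law asymptotic. -/
lemma rpow_asymp_rescale {A d : ℝ} (hA : 0 < A) (hd : 0 < d) {f : ℝ → ℝ}
    (hf : ∃ C > 0, ∃ x0 > 0, ∀ x ≥ x0,
      |f x - A * d * x ^ (-d - 1)| ≤ C * x ^ (-d - 2)) :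
    ∃ C > 0, ∃ s0 > 0, ∀ s ≥ s0,
      |f (A ^ (1 / (d + 1)) * s) - d * s ^ (-d - 1)| ≤ C * s ^ (-d - 2) := by
  obtain ⟨C, hC, x0, hx0, hf⟩ := hf
  have hw : A ^ (1 / (d + 1)) > 0 := Real.rpow_pos_of_pos hA _
  have hwA : A * (A ^ (1 / (d + 1))) ^ (-d - 1) = 1 := by
    rw [← Real.rpow_mul hA.le, show 1 / (d + 1) * (-d - 1) = -1 by field_simp; ring,
      Real.rpow_neg_one, mul_inv_cancel₀ hA.ne']
  set w := A ^ (1 / (d + 1))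
  refine ⟨C * w ^ (-d - 2), by positivity, x0 / w, by positivity, fun s hs => ?_⟩
  have hspos : 0 < s := lt_of_lt_of_le (by positivity) hs
  have h := hf (w * s) (by rwa [ge_iff_le, div_le_iff₀' hw] at hs)
  rw [Real.mul_rpow hw.le hspos.le, Real.mul_rpow hw.le hspos.le] at h
  rwa [show A * d * (w ^ (-d - 1) * s ^ (-d - 1)) = d * s ^ (-d - 1) by
    linear_combination (d * s ^ (-d - 1)) * hwA, ← mul_assoc] at h

/-- The derivative of a concave function on `(0, ∞)` is antitone there. -/
lemma ConcaveOn.antitoneOn_of_hasDerivAt_Ioi {f f' : ℝ → ℝ} (hf : ConcaveOn ℝ (Set.Ioi 0) f)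
    (hderiv : ∀ x > (0 : ℝ), HasDerivAt f (f' x) x) : AntitoneOn f' (Set.Ioi 0) := by
  intro x hx y hy hxy
  have h := hf.antitoneOn_deriv (fun z hz => (hderiv z hz).differentiableAt) hx hy hxy
  rwa [(hderiv x hx).deriv, (hderiv y hy).deriv] at h

/-- Transferring an amount `t` from coordinate `i` to coordinate `j` does not increase a separable
objective at a maximizer over the simplex scaled by `γ`. -/
lemma transfer_le_of_isMax {ι : Type*} [Fintype ι] (F : ι → ℝ → ℝ) {γ : ℝ} (hγ : 0 < γ)
    {p : ι → ℝ} (hp : ∀ k, 0 ≤ p k) (hsum : ∑ k, p k = 1)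
    (hmax : ∀ q : ι → ℝ, (∀ k, 0 ≤ q k) → (∑ k, q k = 1) → q ≠ p →
      ∑ k, F k (γ * q k) < ∑ k, F k (γ * p k))
    {i j : ι} (hij : i ≠ j) {t : ℝ} (ht : 0 < t) (hti : t ≤ γ * p i) :
    F j (γ * p j + t) - F j (γ * p j) ≤ F i (γ * p i) - F i (γ * p i - t) := by
  classical
  set q : ι → ℝ := p + Pi.single j (t / γ) - Pi.single i (t / γ) with hq
  have hqi : q i = p i - t / γ := by simp [hq, hij]
  have hqj : q j = p j + t / γ := by simp [hq, hij.symm]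
  have hqk : ∀ k, k ≠ i ∧ k ≠ j → q k = p k := fun k hk => by simp [hq, hk.1, hk.2]
  have htγ : 0 < t / γ := by positivity
  have hq0 : ∀ k, 0 ≤ q k := by
    intro k
    by_cases hki : k = i
    · rw [hki, hqi, sub_nonneg, div_le_iff₀' hγ]; exact hti
    by_cases hkj : k = j
    · rw [hkj, hqj]; have := hp j; positivity
    rw [hqk k ⟨hki, hkj⟩]; exact hp k
  have hq1 : ∑ k, q k = 1 := by
    simp [hq, Finset.sum_add_distrib, Finset.sum_sub_distrib, hsum]
  have hne : q ≠ p := fun h => by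
    have := congrFun h i
    rw [hqi] at this; linarith
  have hlt := hmax q hq0 hq1 hne
  have hdiff : ∑ k, (F k (γ * q k) - F k (γ * p k)) =
      (F i (γ * q i) - F i (γ * p i)) + (F j (γ * q j) - F j (γ * p j)) :=
    Fintype.sum_eq_add i j hij fun k hk => by rw [hqk k hk, sub_self]
  rw [Finset.sum_sub_distrib, hqi, hqj, mul_sub, mul_add, mul_div_cancel₀ t hγ.ne'] at hdiff
  linarith

/-- If `f'` at `w (s + M)` lies below `g'` at `v s` for all large `s`, then balanced marginal gains
bound `x / w` above by `y / v` plus a constant. -/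
lemma exists_div_le_div_add {f f' g g' : ℝ → ℝ} {w v M T : ℝ} (hw : 0 < w) (hv : 0 < v)
    (hM : 0 < M) (hT : 0 < T)
    (hf : ∀ x > (0 : ℝ), HasDerivAt f (f' x) x) (hf' : AntitoneOn f' (Set.Ioi 0))
    (hgc : ContinuousOn g (Set.Ici 0))
    (hg : ∀ x > (0 : ℝ), HasDerivAt g (g' x) x) (hg' : AntitoneOn g' (Set.Ioi 0))
    (hlt : ∀ s ≥ T, f' (w * (s + M)) < g' (v * s)) :
    ∃ N, ∀ x y : ℝ, 0 ≤ y →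
      (∀ t, 0 < t → t ≤ x → g (y + t) - g y ≤ f x - f (x - t)) → x / w ≤ y / v + N := by
  refine ⟨v * T / w + T + M, fun x y hy h => ?_⟩
  by_contra! hxy
  have ht : 0 < v * T := by positivity
  set t := v * T with htdef
  have hs : T ≤ y / v + T := le_add_of_nonneg_left (by positivity)
  have hys : v * (y / v + T) = y + t := by rw [htdef]; field_simp
  have hz : w * (y / v + T + M) < x - t := by
    rw [lt_div_iff₀ hw] at hxy
    have : t / w * w = t := div_mul_cancel₀ t hw.ne'
    linear_combination hxy - this
  have hz0 : 0 < w * (y / v + T + M) := by positivity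
  have hkey := hlt _ hs
  rw [hys] at hkey
  have hopt := h t ht (by linarith)
  obtain ⟨ξ, hξ, hξe⟩ := exists_hasDerivAt_eq_slope f f' (show x - t < x by linarith)
    (fun u hu => (hf u (by linarith [hu.1])).continuousAt.continuousWithinAt)
    (fun u hu => hf u (by linarith [hu.1]))
  obtain ⟨η, hη, hηe⟩ := exists_hasDerivAt_eq_slope g g' (show y < y + t by linarith)
    (hgc.mono fun u hu => hy.trans hu.1) (fun u hu => hg u (by linarith [hu.1]))
  have h1 : f' ξ ≤ f' (w * (y / v + T + M)) :=
    hf' hz0 (Set.mem_Ioi.mpr (by linarith [hξ.1])) (by linarith [hξ.1])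
  have h2 : g' (y + t) ≤ g' η :=
    hg' (Set.mem_Ioi.mpr (by linarith [hη.1])) (Set.mem_Ioi.mpr (by linarith [hη.1])) hη.2.le
  have h3 : g' η ≤ f' ξ := by
    rw [hξe, hηe, sub_sub_cancel, add_sub_cancel_left]
    gcongr
  linarith

/-- **Asymptotically optimal power allocation, common diversity order.**
In the power allocation setting, if all diversity orders are equal (`D_k = D` for every `k`),
then `p*_k(γ̄) = A_k^{1/(D+1)} / Σ_l A_l^{1/(D+1)} + O(γ̄^{−1})` as `γ̄ → ∞`, uniformly in `k`. -/
theorem asymptotic_power_allocation_common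
    (K : ℕ) (hK : 0 < K)
    (Ibar Ibar' : Fin K → ℝ → ℝ)
    (hcont : ∀ k, ContinuousOn (Ibar k) (Set.Ici 0))
    (hmono : ∀ k, StrictMonoOn (Ibar k) (Set.Ici 0))
    (hderiv : ∀ k, ∀ x > (0 : ℝ), HasDerivAt (Ibar k) (Ibar' k x) x)
    (hderiv_cont : ∀ k, ContinuousOn (Ibar' k) (Set.Ioi 0))
    (hconc : ∀ k, StrictConcaveOn ℝ (Set.Ioi 0) (Ibar k))
    (hlim0 : ∀ k, Tendsto (Ibar' k) (nhdsWithin 0 (Set.Ioi 0)) (nhds 1))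
    (A D : Fin K → ℝ) (hA : ∀ k, 0 < A k) (hD : ∀ k, 0 < D k)
    (hasymp : ∀ k, ∃ C > 0, ∃ x0 > 0, ∀ x ≥ x0,
      |Ibar' k x - A k * D k * x ^ (-(D k) - 1)| ≤ C * x ^ (-(D k) - 2))
    (pstar : ℝ → Fin K → ℝ)
    (hpstar : ∀ γ > (0 : ℝ),
      ((∀ k, 0 ≤ pstar γ k) ∧ ∑ k, pstar γ k = 1) ∧
      ∀ q : Fin K → ℝ, (∀ k, 0 ≤ q k) → (∑ k, q k = 1) → q ≠ pstar γ →
        ∑ k, Ibar k (γ * q k) < ∑ k, Ibar k (γ * pstar γ k))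
    (Dmin : ℝ) (hDmin : IsLeast (Set.range D) Dmin)
    (Dc : ℝ) (hDc : ∀ k, D k = Dc) :
    ∃ C > 0, ∃ γ0 > 0, ∀ γ ≥ γ0, ∀ k,
      |pstar γ k - (A k) ^ ((1 : ℝ) / (Dc + 1)) /
        (∑ l, (A l) ^ ((1 : ℝ) / (Dc + 1)))| ≤ C * γ⁻¹ := by
  obtain rfl : D = fun _ => Dc := funext hDc
  have hd : 0 < Dc := hD ⟨0, hK⟩
  set w : Fin K → ℝ := fun k => A k ^ ((1 : ℝ) / (Dc + 1)) with hwdef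
  have hw : ∀ k, 0 < w k := fun k => Real.rpow_pos_of_pos (hA k) _
  have hanti k := (hconc k).concaveOn.antitoneOn_of_hasDerivAt_Ioi (hderiv k)
  have hpair : ∀ ij : Fin K × Fin K, ∃ N, ∀ γ > 0,
      γ * pstar γ ij.1 / w ij.1 ≤ γ * pstar γ ij.2 / w ij.2 + N := by
    rintro ⟨i, j⟩
    obtain rfl | hij := eq_or_ne i j
    · exact ⟨0, fun γ _ => by simp⟩
    obtain ⟨M, hM, T, hT, hlt⟩ := exists_shift_lt_of_rpow_asymp hd
      (rpow_asymp_rescale (hA i) hd (hasymp i)) (rpow_asymp_rescale (hA j) hd (hasymp j))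
    obtain ⟨N, hN⟩ := exists_div_le_div_add (hw i) (hw j) hM hT (hderiv i) (hanti i) (hcont j)
      (hderiv j) (hanti j) hlt
    refine ⟨N, fun γ hγ => hN _ _ (mul_nonneg hγ.le ((hpstar γ hγ).1.1 j)) fun t ht hti => ?_⟩
    exact transfer_le_of_isMax Ibar hγ (hpstar γ hγ).1.1 (hpstar γ hγ).1.2 (hpstar γ hγ).2 hij
      ht hti
  choose N hN using hpair
  obtain ⟨B, hB⟩ := (Set.finite_range N).bddAbove
  have hbal : ∀ γ > 0, ∀ i j, γ * pstar γ i / w i ≤ γ * pstar γ j / w j + max B 1 :=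
    fun γ hγ i j => (hN (i, j) γ hγ).trans (by
      gcongr; exact (hB ⟨_, rfl⟩).trans (le_max_left _ _))
  have hM : 0 < max B 1 := lt_max_of_lt_right one_pos
  set M := max B 1
  set S := ∑ l, w l with hS
  have hwS : ∀ k, w k ≤ S := fun k =>
    Finset.single_le_sum (f := w) (fun l _ => (hw l).le) (Finset.mem_univ k)
  have hSpos : 0 < S := (hw ⟨0, hK⟩).trans_le (hwS _)
  refine ⟨M * S, by positivity, 1, one_pos, fun γ hγ k => ?_⟩
  have hγ0 : 0 < γ := by linarith
  have htotal : ∑ l, w l * (γ * pstar γ l / w l) = γ := by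
    calc ∑ l, w l * (γ * pstar γ l / w l) = ∑ l, γ * pstar γ l :=
          Finset.sum_congr rfl fun l _ => mul_div_cancel₀ _ (hw l).ne'
      _ = γ := by rw [← Finset.mul_sum, (hpstar γ hγ0).1.2, mul_one]
  have hupper : γ ≤ S * (γ * pstar γ k / w k + M) := by
    conv_lhs => rw [← htotal]
    rw [hS, Finset.sum_mul]
    exact Finset.sum_le_sum fun l _ => mul_le_mul_of_nonneg_left (hbal γ hγ0 l k) (hw l).le
  have hlower : S * (γ * pstar γ k / w k - M) ≤ γ := by
    conv_rhs => rw [← htotal]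
    rw [hS, Finset.sum_mul]
    exact Finset.sum_le_sum fun l _ =>
      mul_le_mul_of_nonneg_left (by linarith [hbal γ hγ0 k l]) (hw l).le
  have hdev : |γ * pstar γ k / w k - γ / S| ≤ M := by
    rw [abs_le]
    constructor
    · have := (div_le_iff₀' hSpos).mpr hupper
      linarith
    · have := (le_div_iff₀' hSpos).mpr hlower
      linarith
  have hfactor : pstar γ k - w k / S = w k * (γ * pstar γ k / w k - γ / S) * γ⁻¹ := by
    have := (hw k).ne'
    field_simp
  rw [hfactor, abs_mul, abs_mul, abs_of_pos (hw k), abs_of_pos (inv_pos.mpr hγ0), mul_comm M S]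
  have := hwS k
  gcongr
end
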